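/- arXiv:1904.10828 — 8 statements merged into one kernel-verified Lean document; each statement's English description precedes it below -/
import Mathlib

section
/- Let F be a field and let K0, K1, K2 be subfields of F with K0 ⊆ K1 ∩ K2. Fix n ≥ 1 and suppose K1 carries pairwise commuting field automorphisms σ1,…,σn and K2 carries pairwise commuting field automorphisms σ1',…,σn' such that for each i the restrictions agree, σi↾K0 = σi'↾K0, and this common restriction is an automorphism of K0. If K1 and K2 are linearly disjoint over K0 inside F, then there exist field automorphisms τ1,…,τn of the composite field K1K2 (the subfield of F generated by K1 ∪ K2) such that τi↾K1 = σi and τi↾K2 = σi' for each i, and the τ1,…,τn pairwise commute. -/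
open scoped TensorProduct

/-- The ring map out of the tensor product over the integers. -/
noncomputable def prodHom {A B M : Type*} [CommRing A] [CommRing B] [CommRing M]
    (f : A →+* M) (g : B →+* M) : A ⊗[ℤ] B →+* M :=
  (Algebra.TensorProduct.productMap f.toIntAlgHom g.toIntAlgHom).toRingHom

theorem prodHom_tmul {A B M : Type*} [CommRing A] [CommRing B] [CommRing M]
    (f : A →+* M) (g : B →+* M) (a : A) (b : B) :
    prodHom f g (a ⊗ₜ[ℤ] b) = f a * g b := by
  simp [prodHom]

/-- Kernel inclusion from linear disjointness. -/
theorem prodHom_ker {F : Type*} [Field F]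
    (K0 K1 K2 : Subfield F) (h01 : K0 ≤ K1) (h02 : K0 ≤ K2)
    (hdisj : ∀ (m : ℕ) (v : Fin m → F), (∀ l, v l ∈ K1) →
      (∀ c : Fin m → F, (∀ l, c l ∈ K0) → (∑ l, c l * v l) = 0 → ∀ l, c l = 0) →
      (∀ c : Fin m → F, (∀ l, c l ∈ K2) → (∑ l, c l * v l) = 0 → ∀ l, c l = 0))
    {M : Type*} [CommRing M] (f : K1 →+* M) (g : K2 →+* M)
    (hfg : ∀ (x : F) (hx : x ∈ K0), f ⟨x, h01 hx⟩ = g ⟨x, h02 hx⟩)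
    (x : K1 ⊗[ℤ] K2) (hx : prodHom K1.subtype K2.subtype x = 0) :
    prodHom f g x = 0 := by
  let _ : Algebra K0 K1 := (Subfield.inclusion h01).toAlgebra
  let b := Module.Basis.ofVectorSpace K0 K1
  have smul_def : ∀ (k : K0) (a : K1), k • a = ⟨k, h01 k.2⟩ * a := fun k a => rfl
  have key : ∀ x : K1 ⊗[ℤ] K2, ∃ c : _ →₀ K2,
      prodHom K1.subtype K2.subtype x = c.sum (fun i k => (k : F) * (b i : F)) ∧
      prodHom f g x = c.sum (fun i k => g k * f (b i)) := by
    intro x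
    induction x using TensorProduct.induction_on with
    | zero => exact ⟨0, by simp, by simp⟩
    | add x y hx hy =>
      obtain ⟨c, hc1, hc2⟩ := hx
      obtain ⟨d, hd1, hd2⟩ := hy
      refine ⟨c + d, ?_, ?_⟩
      · rw [map_add, hc1, hd1, Finsupp.sum_add_index'] <;> simp [add_mul]
      · rw [map_add, hc2, hd2, Finsupp.sum_add_index'] <;> simp [add_mul]
    | tmul a k =>
      have ha : a = (b.repr a).sum (fun i (r : K0) => (⟨r, h01 r.2⟩ : K1) * b i) := by
        conv_lhs => rw [← b.linearCombination_repr a]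
        rw [Finsupp.linearCombination_apply]
        rfl
      refine ⟨(b.repr a).mapRange (fun r : K0 => (⟨r, h02 r.2⟩ : K2) * k) ?_, ?_, ?_⟩
      · ext; simp
      · rw [prodHom_tmul, Finsupp.sum_mapRange_index (by simp)]
        conv_lhs => rw [ha]
        simp only [Finsupp.sum, map_sum, Finset.sum_mul]
        refine Finset.sum_congr rfl fun i _ => ?_
        simp
        ring
      · rw [prodHom_tmul, Finsupp.sum_mapRange_index (by simp)]
        conv_lhs => rw [ha]
        simp only [Finsupp.sum, map_sum, Finset.sum_mul, map_mul]
        refine Finset.sum_congr rfl fun i _ => ?_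
        rw [hfg _ (Subtype.prop _)]
        ring
  obtain ⟨c, hc1, hc2⟩ := key x
  have hc : ∀ i ∈ c.support, (c i : F) = 0 := by
    let e := c.support.equivFin.symm
    have hli : LinearIndependent K0 (fun l => b (e l)) :=
      b.linearIndependent.comp _ (Subtype.val_injective.comp e.injective)
    have := hdisj _ (fun l => (b (e l) : F)) (fun l => (b (e l)).2) ?_
      (fun l => (c (e l) : F)) (fun l => (c (e l)).2) ?_
    · intro i hi
      simpa using this (e.symm ⟨i, hi⟩)
    · intro d hd hsum l
      rw [Fintype.linearIndependent_iff] at hli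
      have := hli (fun l => ⟨d l, hd l⟩) (by
        apply Subtype.ext
        simpa [smul_def] using hsum) l
      simpa using congrArg Subtype.val this
    · rw [hc1, Finsupp.sum, ← Finset.sum_coe_sort] at hx
      rw [← hx]
      exact Equiv.sum_comp e (fun i => (c i : F) * (b i : F))
  rw [hc2, Finsupp.sum]
  refine Finset.sum_eq_zero fun i hi => ?_
  have : c i = 0 := Subtype.ext (hc i hi)
  simp [this]

/-- Uniqueness of extensions to the composite. -/
theorem sup_hom_ext {F : Type*} [Field F] (K1 K2 : Subfield F) {M : Type*} [Field M]
    (f g : ↥(K1 ⊔ K2) →+* M)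
    (h1 : ∀ x (hx : x ∈ K1), f ⟨x, SetLike.le_def.mp le_sup_left hx⟩ =
      g ⟨x, SetLike.le_def.mp le_sup_left hx⟩)
    (h2 : ∀ x (hx : x ∈ K2), f ⟨x, SetLike.le_def.mp le_sup_right hx⟩ =
      g ⟨x, SetLike.le_def.mp le_sup_right hx⟩) : f = g := by
  have : K1 ⊔ K2 ≤ (f.eqLocusField g).map (K1 ⊔ K2).subtype := by
    refine sup_le ?_ ?_
    · intro x hx
      exact ⟨⟨x, SetLike.le_def.mp le_sup_left hx⟩, h1 x hx, rfl⟩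
    · intro x hx
      exact ⟨⟨x, SetLike.le_def.mp le_sup_right hx⟩, h2 x hx, rfl⟩
  ext x
  obtain ⟨y, hy, hyx⟩ := this x.2
  have : y = x := Subtype.ext hyx
  rw [← this]
  exact hy

/-- Existence of an extension from equality of kernels. -/
theorem exists_hom_sup {F : Type*} [Field F] (K1 K2 : Subfield F) {M : Type*} [Field M]
    (f : K1 →+* M) (g : K2 →+* M)
    (hker : ∀ x : K1 ⊗[ℤ] K2, prodHom K1.subtype K2.subtype x = 0 ↔ prodHom f g x = 0) :
    ∃ τ : ↥(K1 ⊔ K2) →+* M,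
      (∀ x (hx : x ∈ K1), τ ⟨x, SetLike.le_def.mp le_sup_left hx⟩ = f ⟨x, hx⟩) ∧
      (∀ x (hx : x ∈ K2), τ ⟨x, SetLike.le_def.mp le_sup_right hx⟩ = g ⟨x, hx⟩) := by
  let p : K1 ⊗[ℤ] K2 →+* ↥(K1 ⊔ K2) :=
    prodHom (Subfield.inclusion le_sup_left) (Subfield.inclusion le_sup_right)
  have hp : ∀ x, (p x : F) = prodHom K1.subtype K2.subtype x := by
    intro x
    induction x using TensorProduct.induction_on with
    | zero => simp
    | add x y hx hy => simp [hx, hy]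
    | tmul a b => simp only [p, prodHom_tmul]; rfl
  let q := prodHom f g
  have hpq : ∀ x, p x = 0 ↔ q x = 0 := by
    intro x
    rw [← hker, ← hp]
    exact (ZeroMemClass.coe_eq_zero).symm
  let q' : p.range →+* M :=
    p.rangeRestrict.liftOfSurjective p.rangeRestrict_surjective
      ⟨q, by
        intro x hx
        rw [RingHom.mem_ker] at hx ⊢
        exact (hpq x).1 (congrArg Subtype.val hx)⟩
  have hq' : ∀ x, q' (p.rangeRestrict x) = q x := fun x =>
    RingHom.liftOfRightInverse_comp_apply _ _ _ _ _
  have hinj : Function.Injective q' := by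
    rw [injective_iff_map_eq_zero]
    intro y hy
    obtain ⟨x, rfl⟩ := p.rangeRestrict_surjective y
    rw [hq'] at hy
    exact Subtype.ext ((hpq x).2 hy)
  have hp1 : ∀ x (hx : x ∈ K1), p (⟨x, hx⟩ ⊗ₜ 1) = ⟨x, SetLike.le_def.mp le_sup_left hx⟩ := by
    intro x hx
    simp only [p, prodHom_tmul, map_one, mul_one]
    rfl
  have hp2 : ∀ x (hx : x ∈ K2), p (1 ⊗ₜ ⟨x, hx⟩) = ⟨x, SetLike.le_def.mp le_sup_right hx⟩ := by
    intro x hx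
    simp only [p, prodHom_tmul, map_one, one_mul]
    rfl
  have : FaithfulSMul p.range ↥(K1 ⊔ K2) :=
    (faithfulSMul_iff_algebraMap_injective _ _).2 Subtype.val_injective
  have : IsFractionRing p.range ↥(K1 ⊔ K2) := by
    refine IsFractionRing.of_field _ _ fun z => ?_
    have hsup : K1 ⊔ K2 = Subfield.closure ((K1 : Set F) ∪ K2) := by
      rw [Subfield.closure_union, Subfield.closure_eq, Subfield.closure_eq]
    have hz : (z : F) ∈ Subfield.closure ((K1 : Set F) ∪ K2) := hsup ▸ z.2
    rw [Subfield.mem_closure_iff] at hz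
    have hle : Subring.closure ((K1 : Set F) ∪ K2) ≤ p.range.map (K1 ⊔ K2).subtype := by
      rw [Subring.closure_le]
      rintro x (hx | hx)
      · exact ⟨_, ⟨_, hp1 x hx⟩, rfl⟩
      · exact ⟨_, ⟨_, hp2 x hx⟩, rfl⟩
    obtain ⟨y, hy, w, hw, hyw⟩ := hz
    obtain ⟨y', hy', rfl⟩ := hle hy
    obtain ⟨w', hw', rfl⟩ := hle hw
    refine ⟨⟨y', hy'⟩, ⟨w', hw'⟩, ?_⟩
    apply Subtype.ext
    exact hyw.symm
  have hl : ∀ x, (IsFractionRing.lift hinj : ↥(K1 ⊔ K2) →+* M) (p x) = q x := by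
    intro x
    rw [← hq']
    exact IsFractionRing.lift_algebraMap hinj (p.rangeRestrict x)
  refine ⟨IsFractionRing.lift hinj, ?_, ?_⟩
  · intro x hx
    rw [← hp1 x hx, hl]
    simp [q, prodHom_tmul]
  · intro x hx
    rw [← hp2 x hx, hl]
    simp [q, prodHom_tmul]

/-- Extension of a compatible pair of automorphisms as an endomorphism. -/
theorem exists_end_sup {F : Type*} [Field F]
    (K0 K1 K2 : Subfield F) (h01 : K0 ≤ K1) (h02 : K0 ≤ K2)
    (hdisj : ∀ (m : ℕ) (v : Fin m → F), (∀ l, v l ∈ K1) →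
      (∀ c : Fin m → F, (∀ l, c l ∈ K0) → (∑ l, c l * v l) = 0 → ∀ l, c l = 0) →
      (∀ c : Fin m → F, (∀ l, c l ∈ K2) → (∑ l, c l * v l) = 0 → ∀ l, c l = 0))
    (s : K1 ≃+* K1) (s' : K2 ≃+* K2)
    (h : ∀ (x : F) (hx : x ∈ K0),
      ((s ⟨x, h01 hx⟩ : ↥K1) : F) = ((s' ⟨x, h02 hx⟩ : ↥K2) : F))
    (h' : ∀ (x : F) (hx : x ∈ K0),
      ((s.symm ⟨x, h01 hx⟩ : ↥K1) : F) = ((s'.symm ⟨x, h02 hx⟩ : ↥K2) : F)) :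
    ∃ τ : ↥(K1 ⊔ K2) →+* ↥(K1 ⊔ K2),
      (∀ x (hx : x ∈ K1), τ ⟨x, SetLike.le_def.mp le_sup_left hx⟩ =
        ⟨s ⟨x, hx⟩, SetLike.le_def.mp le_sup_left (s ⟨x, hx⟩).2⟩) ∧
      (∀ x (hx : x ∈ K2), τ ⟨x, SetLike.le_def.mp le_sup_right hx⟩ =
        ⟨s' ⟨x, hx⟩, SetLike.le_def.mp le_sup_right (s' ⟨x, hx⟩).2⟩) := by
  let i1 : K1 →+* ↥(K1 ⊔ K2) := Subfield.inclusion le_sup_left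
  let i2 : K2 →+* ↥(K1 ⊔ K2) := Subfield.inclusion le_sup_right
  refine exists_hom_sup K1 K2 (i1.comp s) (i2.comp s') fun x => ⟨fun hx => ?_, fun hx => ?_⟩
  · exact prodHom_ker K0 K1 K2 h01 h02 hdisj _ _ (fun x hx => Subtype.ext (h x hx)) x hx
  · let T : K1 ⊗[ℤ] K2 →+* K1 ⊗[ℤ] K2 :=
      (Algebra.TensorProduct.map (s : K1 →+* K1).toIntAlgHom
        (s' : K2 →+* K2).toIntAlgHom).toRingHom
    have hT : ∀ a b, T (a ⊗ₜ b) = s a ⊗ₜ s' b := fun a b => by simp [T]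
    have e1 : ∀ x, prodHom K1.subtype K2.subtype (T x) =
        (prodHom (i1.comp s) (i2.comp s') x : F) := by
      intro x
      induction x using TensorProduct.induction_on with
      | zero => simp
      | add x y hx hy => simp [hx, hy]
      | tmul a b => rw [hT]; simp only [prodHom_tmul]; rfl
    have e2 : ∀ x, prodHom (K1.subtype.comp (s.symm : K1 →+* K1))
        (K2.subtype.comp (s'.symm : K2 →+* K2)) (T x) = prodHom K1.subtype K2.subtype x := by
      intro x
      induction x using TensorProduct.induction_on with
      | zero => simp
      | add x y hx hy => simp [hx, hy]
      | tmul a b => rw [hT]; simp [prodHom_tmul]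
    rw [← e2]
    refine prodHom_ker K0 K1 K2 h01 h02 hdisj _ _ h' (T x) ?_
    rw [e1, hx]
    rfl


/-- commuting extensions of commuting automorphisms of linearly
disjoint subfields to their composite. -/
theorem commuting_extensions_to_composite
    {F : Type*} [Field F] (n : ℕ) (hn : 1 ≤ n)
    (K0 K1 K2 : Subfield F) (h01 : K0 ≤ K1) (h02 : K0 ≤ K2)
    (σ : Fin n → (↥K1 ≃+* ↥K1)) (σ' : Fin n → (↥K2 ≃+* ↥K2))
    (hσcomm : ∀ i j x, σ i (σ j x) = σ j (σ i x))
    (hσ'comm : ∀ i j x, σ' i (σ' j x) = σ' j (σ' i x))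
    -- the restrictions of `σ i` and `σ' i` to `K0` agree
    (hagree : ∀ (i : Fin n) (x : F) (hx : x ∈ K0),
      ((σ i ⟨x, h01 hx⟩ : ↥K1) : F) = ((σ' i ⟨x, h02 hx⟩ : ↥K2) : F))
    -- the common restriction is an automorphism of `K0` (maps `K0` into and onto `K0`)
    (hK0maps : ∀ (i : Fin n) (x : F) (hx : x ∈ K0),
      ((σ i ⟨x, h01 hx⟩ : ↥K1) : F) ∈ K0)
    (hK0surj : ∀ (i : Fin n) (y : F), y ∈ K0 →
      ∃ (x : F) (hx : x ∈ K0), ((σ i ⟨x, h01 hx⟩ : ↥K1) : F) = y)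
    -- `K1` and `K2` are linearly disjoint over `K0` inside `F`
    (hdisj : ∀ (m : ℕ) (v : Fin m → F), (∀ l, v l ∈ K1) →
      (∀ c : Fin m → F, (∀ l, c l ∈ K0) → (∑ l, c l * v l) = 0 → ∀ l, c l = 0) →
      (∀ c : Fin m → F, (∀ l, c l ∈ K2) → (∑ l, c l * v l) = 0 → ∀ l, c l = 0)) :
    ∃ τ : Fin n → (↥(K1 ⊔ K2) ≃+* ↥(K1 ⊔ K2)),
      (∀ i j x, τ i (τ j x) = τ j (τ i x)) ∧
      (∀ (i : Fin n) (x : F) (hx : x ∈ K1),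
        ((τ i ⟨x, SetLike.le_def.mp le_sup_left hx⟩ : ↥(K1 ⊔ K2)) : F)
          = ((σ i ⟨x, hx⟩ : ↥K1) : F)) ∧
      (∀ (i : Fin n) (x : F) (hx : x ∈ K2),
        ((τ i ⟨x, SetLike.le_def.mp le_sup_right hx⟩ : ↥(K1 ⊔ K2)) : F)
          = ((σ' i ⟨x, hx⟩ : ↥K2) : F)) := by

  have hsymm : ∀ (i : Fin n) (x : F) (hx : x ∈ K0),
      (((σ i).symm ⟨x, h01 hx⟩ : ↥K1) : F) = (((σ' i).symm ⟨x, h02 hx⟩ : ↥K2) : F) := by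
    intro i y hy
    obtain ⟨x, hx, hxy⟩ := hK0surj i y hy
    have e1 : (⟨y, h01 hy⟩ : K1) = σ i ⟨x, h01 hx⟩ := Subtype.ext hxy.symm
    have e2 : (⟨y, h02 hy⟩ : K2) = σ' i ⟨x, h02 hx⟩ :=
      Subtype.ext (hxy.symm.trans (hagree i x hx))
    rw [e1, e2, RingEquiv.symm_apply_apply, RingEquiv.symm_apply_apply]
  choose t ht1 ht2 using fun i => exists_end_sup K0 K1 K2 h01 h02 hdisj (σ i) (σ' i)
    (hagree i) (hsymm i)
  choose u hu1 hu2 using fun i => exists_end_sup K0 K1 K2 h01 h02 hdisj (σ i).symm (σ' i).symm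
    (hsymm i) (hagree i)
  have htu : ∀ i, (t i).comp (u i) = RingHom.id _ := by
    intro i
    apply sup_hom_ext
    · intro x hx
      rw [RingHom.comp_apply, hu1 i x hx, ht1 i _ (Subtype.prop _)]
      simp
    · intro x hx
      rw [RingHom.comp_apply, hu2 i x hx, ht2 i _ (Subtype.prop _)]
      simp
  have hut : ∀ i, (u i).comp (t i) = RingHom.id _ := by
    intro i
    apply sup_hom_ext
    · intro x hx
      rw [RingHom.comp_apply, ht1 i x hx, hu1 i _ (Subtype.prop _)]
      simp
    · intro x hx
      rw [RingHom.comp_apply, ht2 i x hx, hu2 i _ (Subtype.prop _)]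
      simp
  have hcomm : ∀ i j, (t i).comp (t j) = (t j).comp (t i) := by
    intro i j
    apply sup_hom_ext
    · intro x hx
      rw [RingHom.comp_apply, RingHom.comp_apply, ht1 i x hx, ht1 j x hx,
        ht1 i _ (Subtype.prop _), ht1 j _ (Subtype.prop _)]
      simp [hσcomm i j]
    · intro x hx
      rw [RingHom.comp_apply, RingHom.comp_apply, ht2 i x hx, ht2 j x hx,
        ht2 i _ (Subtype.prop _), ht2 j _ (Subtype.prop _)]
      simp [hσ'comm i j]
  refine ⟨fun i => RingEquiv.ofRingHom (t i) (u i) (htu i) (hut i), ?_, ?_, ?_⟩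
  · intro i j x
    exact RingHom.congr_fun (hcomm i j) x
  · intro i x hx
    exact congrArg Subtype.val (ht1 i x hx)
  · intro i x hx
    exact congrArg Subtype.val (ht2 i x hx)
end

section
/- Every relatively algebraically closed model of T is a perfect field. -/
universe u

/-- A model of `T`: a field equipped with `n` pairwise commuting field automorphisms. -/
structure TModel (n : ℕ) : Type (u + 1) where
  carrier : Type u
  [fieldInst : Field carrier]
  aut : Fin n → carrier ≃+* carrier
  comm : ∀ i j x, aut i (aut j x) = aut j (aut i x)

attribute [instance] TModel.fieldInst

/-- An embedding of models of `T`: a field embedding commuting with the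
distinguished automorphisms. -/
def IsTEmb {n : ℕ} (K L : TModel.{u} n) (f : K.carrier →+* L.carrier) : Prop :=
  ∀ i x, f (K.aut i x) = L.aut i (f x)

/-- A relatively algebraically closed model of `T`: whenever it embeds (as a model
of `T`) into a model `L` of `T`, every element of `L` which is a root of a nonzero
one-variable polynomial with coefficients in the image already lies in the image. -/
def IsRAC {n : ℕ} (K : TModel.{u} n) : Prop :=
  ∀ (L : TModel.{u} n) (f : K.carrier →+* L.carrier), IsTEmb K L f →
    ∀ b : L.carrier,
      (∃ p : Polynomial K.carrier, p ≠ 0 ∧ Polynomial.eval₂ f b p = 0) → b ∈ f.range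

/-- every relatively algebraically closed model of `T` is a perfect field:
either it has characteristic `0`, or it has prime characteristic `p` and the Frobenius
map `x ↦ x ^ p` is surjective. -/
theorem rac_model_is_perfect {n : ℕ} (hn : 1 ≤ n) (K : TModel.{u} n) (hK : IsRAC K) :
    CharP K.carrier 0 ∨
      ∃ p : ℕ, p.Prime ∧ CharP K.carrier p ∧
        Function.Surjective (fun x : K.carrier => x ^ p) := by
  obtain ⟨p, hp⟩ := CharP.exists K.carrier
  rcases CharP.char_is_prime_or_zero K.carrier p with h | h
  · right
    refine ⟨p, h, hp, fun b => ?_⟩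
    haveI : Fact p.Prime := ⟨h⟩
    -- Frobenius embeds `K` into itself; `b` is a root of `X ^ p - C b` along it.
    obtain ⟨a, ha⟩ := hK K (frobenius K.carrier p)
      (fun i x => by simp [frobenius_def]) b
      ⟨Polynomial.X ^ p - Polynomial.C b,
        Polynomial.X_pow_sub_C_ne_zero h.pos b, by simp [frobenius_def]⟩
    exact ⟨a, ha⟩
  · left
    exact h ▸ hp
end

section
/- Fix n ≥ 1 and let K0, K1, K2 be models of T such that K0 is a submodel of both K1 and K2, K1 is a relatively algebraically closed model of T, and K0 is relatively algebraically closed as a subfield of K1 (i.e., every element of K1 that is algebraic over K0 lies in K0). Then there exist a model L of T such that K1 is a submodel of L, and an embedding of models of T f : K2 → L with f↾K0 = id and K1 ∩ f(K2) = K0. -/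
universe u

open scoped TensorProduct IntermediateField
open Polynomial

section Helpers

theorem aux_minpoly_le {k E Ω : Type*} [Field k] [Field E] [Field Ω] [Algebra k E] [Algebra E Ω]
    [Algebra k Ω] [IsScalarTower k E Ω]
    (h : ∀ b : E, IsIntegral k b → b ∈ (algebraMap k E).range) (α : Ω) (hα : IsIntegral k α) :
    (minpoly k α).natDegree ≤ (minpoly E α).natDegree := by
  have hαE : IsIntegral E α := hα.tower_top
  have hd := minpoly.dvd_map_of_isScalarTower k E α
  have hl : minpoly E α ∈ lifts (algebraMap k E) := by
    rw [lifts_iff_coeff_lifts]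
    intro n
    exact h _ (isIntegral_coeff_of_dvd _ _ (minpoly.monic hα) (minpoly.monic hαE) hd n)
  obtain ⟨q, hq⟩ := (mem_lifts _).1 hl
  have hq0 : q ≠ 0 := by
    rintro rfl
    exact minpoly.ne_zero hαE (by simpa using hq.symm)
  have hr : aeval α q = 0 := by
    rw [← aeval_map_algebraMap E, hq, minpoly.aeval]
  have := natDegree_le_of_dvd (minpoly.dvd k α hr) hq0
  rwa [← hq, natDegree_map]

theorem aux_finite {k M E : Type*} [Field k] [Field E] [Field M] [Algebra k E] [Algebra k M]
    [PerfectField k] [FiniteDimensional k M]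
    (h : ∀ b : E, IsIntegral k b → b ∈ (algebraMap k E).range) : IsDomain (M ⊗[k] E) := by
  let Ω := AlgebraicClosure E
  obtain ⟨α, hα⟩ := Field.exists_primitive_element k M
  let f : M →ₐ[k] Ω := IsAlgClosed.lift
  have hint : IsIntegral k (f α) := (Algebra.IsIntegral.isIntegral (R := k) α).map f
  have hld : (k⟮f α⟯).LinearDisjoint E := by
    refine IntermediateField.LinearDisjoint.of_basis_left
      (IntermediateField.adjoin.powerBasis hint).basis ?_
    have h1 := linearIndependent_pow (K := E) (f α)
    have hle : (IntermediateField.adjoin.powerBasis hint).dim ≤ (minpoly E (f α)).natDegree := by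
      rw [IntermediateField.adjoin.powerBasis_dim]
      exact aux_minpoly_le h _ hint
    have h2 := h1.comp (Fin.castLE hle) (Fin.castLE_injective hle)
    convert h2 using 1
    funext i
    simp
  have hD := hld.isDomain
  have e : f.fieldRange = k⟮f α⟯ := by
    rw [AlgHom.fieldRange_eq_map, ← hα, IntermediateField.adjoin_map, Set.image_singleton]
  let e1 : M ≃ₐ[k] k⟮f α⟯ := (AlgEquiv.ofInjectiveField f).trans (IntermediateField.equivOfEq e)
  exact (Algebra.TensorProduct.congr e1 (AlgEquiv.refl : E ≃ₐ[k] E)).toMulEquiv.isDomain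

theorem aux_repr {k A A' E ι : Type*} [Field k] [CommRing A] [CommRing A'] [Field E] [Algebra k A]
    [Algebra k A'] [Algebra k E] (b : Module.Basis ι k E) (φ : A →ₐ[k] A') (z : A ⊗[k] E) (i : ι) :
    (Algebra.TensorProduct.basis A' b).repr
      (Algebra.TensorProduct.map φ (AlgHom.id k E) z) i =
      φ ((Algebra.TensorProduct.basis A b).repr z i) := by
  induction z with
  | zero => simp
  | add x y hx hy => simp [hx, hy]
  | tmul x y => simp [Algebra.TensorProduct.basis_repr_tmul]

theorem aux_lift {k F E ι : Type*} [Field k] [Field F] [Field E] [Algebra k F] [Algebra k E]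
    (b : Module.Basis ι k E) (B : Subalgebra k F) (x : F ⊗[k] E)
    (hx : ∀ i, (Algebra.TensorProduct.basis F b).repr x i ∈ B) :
    ∃ x' : B ⊗[k] E, Algebra.TensorProduct.map B.val (AlgHom.id k E) x' = x := by
  classical
  refine ⟨∑ i ∈ ((Algebra.TensorProduct.basis F b).repr x).support,
    (⟨_, hx i⟩ : B) ⊗ₜ[k] b i, ?_⟩
  conv_rhs => rw [← (Algebra.TensorProduct.basis F b).linearCombination_repr x]
  rw [Finsupp.linearCombination_apply, Finsupp.sum, map_sum]
  refine Finset.sum_congr rfl fun i _ => ?_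
  simp [TensorProduct.smul_tmul']

theorem aux_domain {k F E : Type*} [Field k] [Field F] [Field E] [Algebra k F] [Algebra k E]
    [PerfectField k]
    (h : ∀ b : E, IsIntegral k b → b ∈ (algebraMap k E).range) : IsDomain (F ⊗[k] E) := by
  classical
  have : NoZeroDivisors (F ⊗[k] E) := by
    refine ⟨fun {x y} hxy => ?_⟩
    by_contra! hne
    obtain ⟨hx0, hy0⟩ := hne
    let b := Module.Basis.ofVectorSpace k E
    let bF := Algebra.TensorProduct.basis F b
    obtain ⟨i, hi⟩ : ∃ i, bF.repr x i ≠ 0 := by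
      by_contra! hc
      exact hx0 (bF.repr.map_eq_zero_iff.1 (Finsupp.ext hc))
    obtain ⟨j, hj⟩ : ∃ j, bF.repr y j ≠ 0 := by
      by_contra! hc
      exact hy0 (bF.repr.map_eq_zero_iff.1 (Finsupp.ext hc))
    let S : Finset F := (bF.repr x).support.image (bF.repr x) ∪
      (bF.repr y).support.image (bF.repr y) ∪ {(bF.repr x i)⁻¹, (bF.repr y j)⁻¹}
    let B : Subalgebra k F := Algebra.adjoin k (S : Set F)
    have hS : ∀ s ∈ S, s ∈ B := fun s hs => Algebra.subset_adjoin hs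
    have hxB : ∀ l, bF.repr x l ∈ B := by
      intro l
      by_cases hl : bF.repr x l = 0
      · rw [hl]; exact B.zero_mem
      · refine hS _ (Finset.mem_union_left _ (Finset.mem_union_left _ ?_))
        exact Finset.mem_image_of_mem _ (Finsupp.mem_support_iff.2 hl)
    have hyB : ∀ l, bF.repr y l ∈ B := by
      intro l
      by_cases hl : bF.repr y l = 0
      · rw [hl]; exact B.zero_mem
      · refine hS _ (Finset.mem_union_left _ (Finset.mem_union_right _ ?_))
        exact Finset.mem_image_of_mem _ (Finsupp.mem_support_iff.2 hl)
    have hxi : (bF.repr x i)⁻¹ ∈ B := hS _ (Finset.mem_union_right _ (by simp))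
    have hyi : (bF.repr y j)⁻¹ ∈ B := hS _ (Finset.mem_union_right _ (by simp))
    obtain ⟨x', hx'⟩ := aux_lift b B x hxB
    obtain ⟨y', hy'⟩ := aux_lift b B y hyB
    have hinj : Function.Injective (Algebra.TensorProduct.map B.val (AlgHom.id k E)) :=
      Module.Flat.rTensor_preserves_injective_linearMap (M := E) B.val.toLinearMap
        Subtype.val_injective
    have hxy' : x' * y' = 0 := by
      apply hinj
      rw [map_mul, hx', hy', hxy, map_zero]
    have : Algebra.FiniteType k B :=
      (Subalgebra.fg_iff_finiteType B).1 (Subalgebra.fg_adjoin_finset S)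
    obtain ⟨m, hm⟩ := Ideal.exists_maximal B
    let : Field (B ⧸ m) := Ideal.Quotient.field m
    have : Algebra.FiniteType k (B ⧸ m) :=
      Algebra.FiniteType.of_surjective (Ideal.Quotient.mkₐ k m) (Ideal.Quotient.mkₐ_surjective k m)
    have : Module.Finite k (B ⧸ m) := finite_of_finite_type_of_isJacobsonRing k (B ⧸ m)
    have : IsDomain ((B ⧸ m) ⊗[k] E) := aux_finite h
    let π : B →ₐ[k] B ⧸ m := Ideal.Quotient.mkₐ k m
    have key : ∀ (z : F ⊗[k] E) (z' : B ⊗[k] E) (l), 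
        Algebra.TensorProduct.map B.val (AlgHom.id k E) z' = z → bF.repr z l ≠ 0 →
        (bF.repr z l)⁻¹ ∈ B → Algebra.TensorProduct.map π (AlgHom.id k E) z' ≠ 0 := by
      intro z z' l hz hl hB h0
      have h1 := aux_repr b π z' l
      have h2 := aux_repr b B.val z' l
      rw [hz] at h2
      rw [h0] at h1
      set c := (Algebra.TensorProduct.basis B b).repr z' l with hc
      have hu : c * ⟨_, hB⟩ = 1 := by
        apply Subtype.ext
        change (c : F) * (bF.repr z l)⁻¹ = 1
        rw [show bF.repr z l = (c : F) from h2]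
        exact mul_inv_cancel₀ (by rw [← show bF.repr z l = (c : F) from h2]; exact hl)
      have h3 := congrArg π hu
      rw [map_mul, ← h1, map_one] at h3
      simp at h3
    have := congrArg (Algebra.TensorProduct.map π (AlgHom.id k E)) hxy'
    rw [map_mul, map_zero] at this
    rcases mul_eq_zero.1 this with h0 | h0
    · exact key x x' i hx' hi hxi h0
    · exact key y y' j hy' hj hyi h0
  have : Nontrivial (F ⊗[k] E) := 
    (Algebra.TensorProduct.includeLeft_injective (R := k) (S := k) (A := F) (B := E) 
      (algebraMap k E).injective).nontrivial
  exact NoZeroDivisors.to_isDomain _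

theorem aux_tlift {k A B C : Type*} [Field k] [CommRing A] [CommRing B] [CommRing C] [Algebra k A]
    [Algebra k B] (f : A →+* C) (g : B →+* C)
    (hfg : f.comp (algebraMap k A) = g.comp (algebraMap k B)) :
    ∃ h : A ⊗[k] B →+* C, (∀ a, h (a ⊗ₜ 1) = f a) ∧ (∀ b, h (1 ⊗ₜ b) = g b) := by
  let : Algebra k C := (f.comp (algebraMap k A)).toAlgebra
  let f' : A →ₐ[k] C := { f with commutes' := fun r => rfl }
  let g' : B →ₐ[k] C := { g with commutes' := fun r => (RingHom.congr_fun hfg r).symm }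
  refine ⟨(Algebra.TensorProduct.lift f' g' fun _ _ => Commute.all _ _ : A ⊗[k] B →ₐ[k] C), 
    fun a => ?_, fun b => ?_⟩
  · simp [f']
  · simp [g']

theorem aux_text {k A B C : Type*} [Field k] [CommRing A] [CommRing B] [CommRing C] [Algebra k A]
    [Algebra k B] {f g : A ⊗[k] B →+* C} (h1 : ∀ a, f (a ⊗ₜ 1) = g (a ⊗ₜ 1))
    (h2 : ∀ b, f (1 ⊗ₜ b) = g (1 ⊗ₜ b)) : f = g := by
  refine RingHom.ext fun z => ?_
  induction z with
  | zero => simp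
  | add x y hx hy => simp [hx, hy]
  | tmul x y =>
    have : x ⊗ₜ[k] y = (x ⊗ₜ 1) * (1 ⊗ₜ y) := by simp
    rw [this, map_mul, map_mul, h1, h2]

/-- A pair of compatible automorphisms induces an automorphism of the tensor product. -/
theorem aux_equiv {k A B : Type*} [Field k] [CommRing A] [CommRing B] [Algebra k A]
    [Algebra k B] (s : k ≃+* k) (f : A ≃+* A) (g : B ≃+* B)
    (hf : ∀ x, f (algebraMap k A x) = algebraMap k A (s x))
    (hg : ∀ x, g (algebraMap k B x) = algebraMap k B (s x)) :
    ∃ h : A ⊗[k] B ≃+* A ⊗[k] B,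
      (∀ a, h (a ⊗ₜ 1) = f a ⊗ₜ 1) ∧ (∀ b, h (1 ⊗ₜ b) = 1 ⊗ₜ g b) := by
  have main : ∀ (s : k ≃+* k) (f : A ≃+* A) (g : B ≃+* B)
      (_ : ∀ x, f (algebraMap k A x) = algebraMap k A (s x))
      (_ : ∀ x, g (algebraMap k B x) = algebraMap k B (s x)),
      ∃ h : A ⊗[k] B →+* A ⊗[k] B,
        (∀ a, h (a ⊗ₜ 1) = f a ⊗ₜ 1) ∧ (∀ b, h (1 ⊗ₜ b) = 1 ⊗ₜ g b) := by
    intro s f g hf hg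
    refine aux_tlift 
      ((Algebra.TensorProduct.includeLeft : A →ₐ[k] A ⊗[k] B).toRingHom.comp f.toRingHom)
      ((Algebra.TensorProduct.includeRight : B →ₐ[k] A ⊗[k] B).toRingHom.comp g.toRingHom) ?_
    ext x
    change (f (algebraMap k A x)) ⊗ₜ[k] (1 : B) = (1 : A) ⊗ₜ[k] (g (algebraMap k B x))
    rw [hf, hg, Algebra.algebraMap_eq_smul_one, Algebra.algebraMap_eq_smul_one,
      TensorProduct.smul_tmul]
  obtain ⟨h, h1, h2⟩ := main s f g hf hg
  obtain ⟨h', h1', h2'⟩ := main s.symm f.symm g.symm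
    (fun x => by rw [RingEquiv.symm_apply_eq, hf, RingEquiv.apply_symm_apply])
    (fun x => by rw [RingEquiv.symm_apply_eq, hg, RingEquiv.apply_symm_apply])
  refine ⟨RingEquiv.ofRingHom h h' (aux_text ?_ ?_) (aux_text ?_ ?_), h1, h2⟩ <;> intro a <;>
    simp [h1, h2, h1', h2']

theorem aux_inter {k A B : Type*} [Field k] [Field A] [Field B] [Algebra k A] [Algebra k B]
    (x : B) (y : A) (h : (1 : A) ⊗ₜ[k] x = y ⊗ₜ[k] (1 : B)) : ∃ a : k, y = algebraMap k A a := by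
  obtain ⟨g, hg⟩ := LinearMap.exists_leftInverse_of_injective (Algebra.linearMap k B)
    (LinearMap.ker_eq_bot.2 (algebraMap k B).injective)
  have hg1 : g 1 = 1 := by simpa using LinearMap.congr_fun hg 1
  refine ⟨g x, ?_⟩
  have := congrArg (TensorProduct.rid k A ∘ g.lTensor A) h
  simp [hg1] at this
  rw [← this, Algebra.algebraMap_eq_smul_one]

end Helpers

theorem aux_perfect {n : ℕ} (K0 K1 : TModel.{u} n)
    (e1 : K0.carrier →+* K1.carrier) 
    (hK1 : IsRAC K1)
    (hK0rc : ∀ b : K1.carrier,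
      (∃ p : Polynomial K0.carrier, p ≠ 0 ∧ Polynomial.eval₂ e1 b p = 0) → b ∈ e1.range) :
    PerfectField K0.carrier := by
  obtain ⟨p, hp⟩ := ExpChar.exists K0.carrier
  have hpos : 0 < p := expChar_pos K0.carrier p
  have : ExpChar K1.carrier p := expChar_of_injective_ringHom e1.injective p
  have : PerfectRing K0.carrier p := by
    refine PerfectRing.ofSurjective _ _ fun a => ?_
    obtain ⟨c, hc⟩ := hK1 K1 (frobenius K1.carrier p) (fun i x => by simp [frobenius_def]) (e1 a)
      ⟨X ^ p - C (e1 a), X_pow_sub_C_ne_zero hpos _, by simp [frobenius_def]⟩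
    obtain ⟨d, rfl⟩ := hK0rc c ⟨X ^ p - C a, X_pow_sub_C_ne_zero hpos _, by
      simp [← hc, frobenius_def]⟩
    refine ⟨d, e1.injective ?_⟩
    rw [← hc]
    simp [frobenius_def]
  exact PerfectRing.toPerfectField _ p

theorem amalgamation_over_relatively_closed_base {n : ℕ} (hn : 1 ≤ n)
    (K0 K1 K2 : TModel.{u} n)
    (e1 : K0.carrier →+* K1.carrier) (he1 : IsTEmb K0 K1 e1)
    (e2 : K0.carrier →+* K2.carrier) (he2 : IsTEmb K0 K2 e2)
    (hK1 : IsRAC K1)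
    (hK0rc : ∀ b : K1.carrier,
      (∃ p : Polynomial K0.carrier, p ≠ 0 ∧ Polynomial.eval₂ e1 b p = 0) → b ∈ e1.range) :
    ∃ (L : TModel.{u} n) (g1 : K1.carrier →+* L.carrier) (g2 : K2.carrier →+* L.carrier),
      IsTEmb K1 L g1 ∧ IsTEmb K2 L g2 ∧
      g1.comp e1 = g2.comp e2 ∧
      g1.range ⊓ g2.range = (g1.comp e1).range := by
  have := aux_perfect K0 K1 e1 hK1 hK0rc
  let : Algebra K0.carrier K1.carrier := e1.toAlgebra
  let : Algebra K0.carrier K2.carrier := e2.toAlgebra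
  have hD : IsDomain (K2.carrier ⊗[K0.carrier] K1.carrier) :=
    aux_domain fun b ⟨p, hp, hb⟩ => hK0rc b ⟨p, hp.ne_zero, hb⟩
  have hs := fun i => aux_equiv (K0.aut i) (K2.aut i) (K1.aut i)
    (fun x => (he2 i x).symm) (fun x => (he1 i x).symm)
  choose s hs2 hs1 using hs
  let Q := FractionRing (K2.carrier ⊗[K0.carrier] K1.carrier)
  let D := K2.carrier ⊗[K0.carrier] K1.carrier
  have hcomm : ∀ i j, (s i).toRingHom.comp (s j).toRingHom =
      (s j).toRingHom.comp (s i).toRingHom := by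
    intro i j
    refine aux_text (fun a => ?_) (fun a => ?_)
    · change s i (s j _) = s j (s i _)
      simp only [hs2, K2.comm i j]
    · change s i (s j _) = s j (s i _)
      simp only [hs1, K1.comm i j]
  let t : Fin n → Q ≃+* Q := fun i => IsFractionRing.ringEquivOfRingEquiv (s i)
  have ht : ∀ i (z : D), t i (algebraMap D Q z) = algebraMap D Q (s i z) := fun i z =>
    IsFractionRing.ringEquivOfRingEquiv_algebraMap (s i) z
  have htc : ∀ i j x, t i (t j x) = t j (t i x) := by
    intro i j x
    have : (t i).toRingHom.comp (t j).toRingHom = (t j).toRingHom.comp (t i).toRingHom := by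
      refine IsLocalization.ringHom_ext (nonZeroDivisors D) ?_
      refine RingHom.ext fun z => ?_
      change t i (t j (algebraMap D Q z)) = t j (t i (algebraMap D Q z))
      rw [ht, ht, ht, ht]
      exact congrArg _ (RingHom.congr_fun (hcomm i j) z)
    exact RingHom.congr_fun this x
  let g1 : K1.carrier →+* Q := (algebraMap D Q).comp
    (Algebra.TensorProduct.includeRight : K1.carrier →ₐ[K0.carrier] D).toRingHom
  let g2 : K2.carrier →+* Q := (algebraMap D Q).comp
    (Algebra.TensorProduct.includeLeft : K2.carrier →ₐ[K0.carrier] D).toRingHom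
  have hg : g1.comp e1 = g2.comp e2 := by
    ext x
    refine congrArg (algebraMap D Q) ?_
    change (1 : K2.carrier) ⊗ₜ[K0.carrier] (algebraMap K0.carrier K1.carrier x) =
      (algebraMap K0.carrier K2.carrier x) ⊗ₜ[K0.carrier] (1 : K1.carrier)
    rw [Algebra.algebraMap_eq_smul_one, Algebra.algebraMap_eq_smul_one,
      TensorProduct.smul_tmul]
  refine ⟨⟨Q, t, htc⟩, g1, g2, fun i x => ?_, fun i x => ?_, hg, ?_⟩
  · change algebraMap D Q (1 ⊗ₜ K1.aut i x) = t i (algebraMap D Q (1 ⊗ₜ x))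
    rw [ht, hs1]
  · change algebraMap D Q (K2.aut i x ⊗ₜ 1) = t i (algebraMap D Q (x ⊗ₜ 1))
    rw [ht, hs2]
  · apply le_antisymm
    · rintro z ⟨⟨x, hx⟩, ⟨y, hy⟩⟩
      have hxy : (1 : K2.carrier) ⊗ₜ[K0.carrier] x = y ⊗ₜ[K0.carrier] (1 : K1.carrier) :=
        IsFractionRing.injective D Q (hx.trans hy.symm)
      obtain ⟨a, rfl⟩ := aux_inter x y hxy
      exact ⟨a, (RingHom.congr_fun hg a).trans hy⟩
    · rintro z ⟨a, rfl⟩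
      exact ⟨⟨e1 a, rfl⟩, ⟨e2 a, (RingHom.congr_fun hg a).symm⟩⟩
end

section
/- Fix n ≥ 1, let M be a relatively algebraically closed model of T, and let A ⊆ M. Then acl_σ^M(A), equipped with the restrictions of the distinguished automorphisms of M, is itself a relatively algebraically closed model of T. -/
universe u

/-- The defining property of `acl_σ^M(A)`: a subfield of `M` containing `A`, closed
under the distinguished automorphisms and their inverses, and relatively algebraically
closed in `M`. -/
def IsSigmaClosed {n : ℕ} (M : TModel.{u} n) (A : Set M.carrier)
    (N : Subfield M.carrier) : Prop :=
  A ⊆ N ∧ (∀ i, ∀ x ∈ N, M.aut i x ∈ N) ∧ (∀ i, ∀ x ∈ N, (M.aut i).symm x ∈ N) ∧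
    ∀ x : M.carrier,
      (∃ p : Polynomial ↥N, p ≠ 0 ∧ Polynomial.eval₂ N.subtype x p = 0) → x ∈ N

open scoped TensorProduct

/-- Restriction of a ring automorphism to a stable subring-like object. -/
def restrictEquiv {R S : Type*} [Ring R] [SetLike S R] [SubringClass S R] (s : S) (e : R ≃+* R)
    (h₁ : ∀ x ∈ s, e x ∈ s) (h₂ : ∀ x ∈ s, e.symm x ∈ s) : s ≃+* s where
  toFun x := ⟨e x, h₁ x x.2⟩
  invFun x := ⟨e.symm x, h₂ x x.2⟩
  left_inv x := by simp
  right_inv x := by simp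
  map_mul' x y := by ext; simp
  map_add' x y := by ext; simp

theorem natDegree_minpoly_le {F E : Type*} [Field F] [Field E] [Algebra F E]
    (B : IntermediateField F E)
    (hB : ∀ x : B, IsIntegral F x → x ∈ (algebraMap F B).range) (a : E) (ha : IsIntegral F a) :
    (minpoly F a).natDegree ≤ (minpoly B a).natDegree := by
  have hdvd : minpoly B a ∣ (minpoly F a).map (algebraMap F B) :=
    minpoly.dvd_map_of_isScalarTower F B a
  have hmon : (minpoly B a).Monic := minpoly.monic ha.tower_top
  have hc := Polynomial.isIntegral_coeff_of_dvd (minpoly F a) (minpoly B a)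
    (minpoly.monic ha) hmon hdvd
  have hl : minpoly B a ∈ Polynomial.lifts (algebraMap F B) := by
    rw [Polynomial.lifts_iff_coeff_lifts]
    intro i
    exact hB _ (hc i)
  obtain ⟨g, hg, hdeg, hgm⟩ := Polynomial.lifts_and_natDegree_eq_and_monic hl hmon
  rw [← hdeg]
  apply Polynomial.natDegree_le_of_dvd _ hgm.ne_zero
  apply minpoly.dvd
  have h := minpoly.aeval B a
  rw [← hg, Polynomial.aeval_map_algebraMap] at h
  exact h

theorem linearDisjoint_of_rel_closed {F E : Type*} [Field F] [PerfectField F] [Field E]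
    [Algebra F E] (A B : IntermediateField F E) [Algebra.IsAlgebraic F A]
    (hB : ∀ x : B, IsIntegral F x → x ∈ (algebraMap F B).range) : A.LinearDisjoint B := by
  rw [IntermediateField.linearDisjoint_iff']
  have : Algebra.IsIntegral F A.toSubalgebra := inferInstanceAs (Algebra.IsIntegral F A)
  apply Subalgebra.LinearDisjoint.of_linearDisjoint_finite_left
  intro A' hA' hfin
  have hfld : IsField A' := isField_of_isIntegral_of_isField' (Field.toIsField F)
  obtain ⟨C, rfl⟩ : ∃ C : IntermediateField F E, C.toSubalgebra = A' :=
    ⟨A'.toIntermediateField' hfld, rfl⟩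
  rw [← IntermediateField.linearDisjoint_iff']
  have : FiniteDimensional F C := hfin
  let pb := Field.powerBasisOfFiniteOfSeparable F C
  apply IntermediateField.LinearDisjoint.of_basis_left pb.basis
  have hint : IsIntegral F (pb.gen : E) := (pb.isIntegral_gen).map C.val
  have hle : pb.dim ≤ (minpoly B (pb.gen : E)).natDegree := by
    rw [← pb.natDegree_minpoly]
    refine le_trans (le_of_eq ?_) (natDegree_minpoly_le B hB _ hint)
    rw [← minpoly.algebraMap_eq (algebraMap C E).injective]
    rfl
  have hli := (linearIndependent_pow (K := B) (pb.gen : E)).comp (Fin.castLE hle)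
    (Fin.castLE_injective hle)
  convert hli using 1
  ext i
  simp

theorem isField_tensor {F A B : Type*} [Field F] [PerfectField F] [Field A] [Field B]
    [Algebra F A] [Algebra F B] [Algebra.IsAlgebraic F A]
    (hB : ∀ x : B, IsIntegral F x → x ∈ (algebraMap F B).range) : IsField (A ⊗[F] B) := by
  apply IntermediateField.LinearDisjoint.isField_of_forall
  intro K _ _ fa fb
  have : Algebra.IsAlgebraic F fa.fieldRange :=
    (AlgEquiv.ofInjectiveField fa).isAlgebraic
  apply linearDisjoint_of_rel_closed
  rintro ⟨_, y, rfl⟩ hx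
  have h1 : IsIntegral F (fb y) := hx.map fb.fieldRange.val
  have h2 : IsIntegral F y := (isIntegral_algHom_iff fb fb.injective).1 h1
  obtain ⟨z, rfl⟩ := hB y h2
  refine ⟨z, ?_⟩
  ext
  simp

theorem exists_tensor_hom {F A B : Type*} [Field F] [Field A] [Field B]
    [Algebra F A] [Algebra F B] (τ : F →+* F) (α : A →+* A) (β : B →+* B)
    (hα : ∀ x, α (algebraMap F A x) = algebraMap F A (τ x))
    (hβ : ∀ x, β (algebraMap F B x) = algebraMap F B (τ x)) :
    ∃ e : A ⊗[F] B →+* A ⊗[F] B, ∀ a b, e (a ⊗ₜ b) = α a ⊗ₜ β b := by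
  let fa : A →ₛₗ[τ] A :=
    { toFun := α, map_add' := map_add α,
      map_smul' := fun c x => by simp [Algebra.smul_def, hα] }
  let fb : B →ₛₗ[τ] B :=
    { toFun := β, map_add' := map_add β,
      map_smul' := fun c x => by simp [Algebra.smul_def, hβ] }
  let m := TensorProduct.map fa fb
  have hm : ∀ a b, m (a ⊗ₜ b) = α a ⊗ₜ β b := fun a b => TensorProduct.map_tmul _ _ _ _
  refine ⟨{ toFun := m, map_one' := ?_, map_mul' := ?_, map_zero' := map_zero m,
            map_add' := map_add m }, hm⟩
  · rw [Algebra.TensorProduct.one_def, hm]; simp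
  · intro x y
    induction x with
    | zero => simp
    | add x x' hx hx' => simp only [add_mul, map_add, hx, hx']
    | tmul a b =>
      induction y with
      | zero => simp
      | add y y' hy hy' => simp only [mul_add, map_add, hy, hy']
      | tmul c d => simp [hm, Algebra.TensorProduct.tmul_mul_tmul]

theorem tensor_hom_ext {F A B C : Type*} [Field F] [Field A] [Field B]
    [Algebra F A] [Algebra F B] [Semiring C] (f g : A ⊗[F] B →+* C)
    (h : ∀ a b, f (a ⊗ₜ b) = g (a ⊗ₜ b)) (x : A ⊗[F] B) : f x = g x := by
  induction x with
  | zero => simp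
  | add x y hx hy => simp [hx, hy]
  | tmul a b => exact h a b

theorem exists_tensor_equiv {F A B : Type*} [Field F] [Field A] [Field B]
    [Algebra F A] [Algebra F B] (τ : F ≃+* F) (α : A ≃+* A) (β : B ≃+* B)
    (hα : ∀ x, α (algebraMap F A x) = algebraMap F A (τ x))
    (hβ : ∀ x, β (algebraMap F B x) = algebraMap F B (τ x)) :
    ∃ e : A ⊗[F] B ≃+* A ⊗[F] B, ∀ a b, e (a ⊗ₜ b) = α a ⊗ₜ β b := by
  obtain ⟨e, he⟩ := exists_tensor_hom τ.toRingHom α.toRingHom β.toRingHom hα hβ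
  obtain ⟨e', he'⟩ := exists_tensor_hom τ.symm.toRingHom α.symm.toRingHom β.symm.toRingHom
    (fun x => (RingEquiv.symm_apply_eq α).2 (by simp [hα]))
    (fun x => (RingEquiv.symm_apply_eq β).2 (by simp [hβ]))
  refine ⟨RingEquiv.ofRingHom e e' ?_ ?_, he⟩
  · refine RingHom.ext fun x => ?_
    exact tensor_hom_ext _ (RingHom.id _) (fun a b => by simp [he, he']) x
  · refine RingHom.ext fun x => ?_
    exact tensor_hom_ext _ (RingHom.id _) (fun a b => by simp [he, he']) x

theorem rac_frobenius_surjective {n : ℕ} (M : TModel.{u} n) (hM : IsRAC M) (p : ℕ)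
    [ExpChar M.carrier p] : Function.Surjective (frobenius M.carrier p) := by
  intro b
  have hp : 0 < p := expChar_pos M.carrier p
  refine hM M (frobenius M.carrier p) (fun i x => by simp [frobenius_def]) b
    ⟨Polynomial.X ^ p - Polynomial.C b, Polynomial.X_pow_sub_C_ne_zero hp b, ?_⟩
  simp [frobenius_def]

theorem rac_of_rel_closed {n : ℕ} (K M : TModel.{u} n) (hM : IsRAC M)
    (g : K.carrier →+* M.carrier) (hg : IsTEmb K M g)
    (hrel : ∀ x : M.carrier,
      (∃ p : Polynomial K.carrier, p ≠ 0 ∧ Polynomial.eval₂ g x p = 0) → x ∈ g.range) :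
    IsRAC K := by
  intro L f hf b hb
  -- `K` is perfect
  obtain ⟨p, hp⟩ := ExpChar.exists K.carrier
  have hpM : ExpChar M.carrier p := expChar_of_injective_ringHom g.injective p
  have hperf : PerfectRing K.carrier p := by
    apply PerfectRing.ofSurjective
    intro x
    obtain ⟨y, hy⟩ := rac_frobenius_surjective M hM p (g x)
    rw [frobenius_def] at hy
    obtain ⟨z, rfl⟩ := hrel y ⟨Polynomial.X ^ p - Polynomial.C x,
      Polynomial.X_pow_sub_C_ne_zero (expChar_pos K.carrier p) x, by simp [hy]⟩
    refine ⟨z, g.injective ?_⟩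
    rw [frobenius_def, map_pow, hy]
  have : PerfectField K.carrier := PerfectRing.toPerfectField K.carrier p
  letI : Algebra K.carrier L.carrier := f.toAlgebra
  letI : Algebra K.carrier M.carrier := g.toAlgebra
  have hB : ∀ x : M.carrier, IsIntegral K.carrier x →
      x ∈ (algebraMap K.carrier M.carrier).range := by
    rintro x ⟨q, hq, hx⟩
    exact hrel x ⟨q, hq.ne_zero, hx⟩
  -- the algebraic part of `L`
  let A : IntermediateField K.carrier L.carrier := algebraicClosure K.carrier L.carrier
  have hA : ∀ x : L.carrier, x ∈ A ↔ IsAlgebraic K.carrier x := fun x =>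
    mem_algebraicClosure_iff
  have htr : ∀ (σ : K.carrier →+* K.carrier) (θ : L.carrier →+* L.carrier),
      (∀ x, θ (f x) = f (σ x)) → ∀ x ∈ A, θ x ∈ A := by
    intro σ θ h x hx
    rw [hA] at hx ⊢
    obtain ⟨q, hq, hx⟩ := hx
    refine ⟨q.map σ, (Polynomial.map_ne_zero_iff σ.injective).2 hq, ?_⟩
    have h0 : Polynomial.eval₂ f x q = 0 := hx
    change Polynomial.eval₂ f (θ x) (q.map σ) = 0
    have hc : f.comp σ = θ.comp f := RingHom.ext fun y => (h y).symm
    rw [Polynomial.eval₂_map, hc, ← Polynomial.hom_eval₂, h0, map_zero]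
  let α : Fin n → A ≃+* A := fun i => restrictEquiv A (L.aut i)
    (htr (K.aut i).toRingHom (L.aut i).toRingHom fun x => (hf i x).symm)
    (htr (K.aut i).symm.toRingHom (L.aut i).symm.toRingHom fun x =>
      (RingEquiv.symm_apply_eq (L.aut i)).2 (by
        rw [← hf]; simp))
  have hα : ∀ i x, α i (algebraMap K.carrier A x) = algebraMap K.carrier A (K.aut i x) := by
    intro i x
    ext
    exact (hf i x).symm
  have hβ : ∀ i x, M.aut i (algebraMap K.carrier M.carrier x) =
      algebraMap K.carrier M.carrier (K.aut i x) := fun i x => (hg i x).symm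
  choose e he using fun i => exists_tensor_equiv (K.aut i) (α i) (M.aut i) (hα i) (hβ i)
  have hfield : IsField (A ⊗[K.carrier] M.carrier) := isField_tensor hB
  letI : Field (A ⊗[K.carrier] M.carrier) := hfield.toField
  have hcomm : ∀ i j x, e i (e j x) = e j (e i x) := by
    intro i j x
    induction x with
    | zero => simp only [map_zero]
    | add x y hx hy => simp only [map_add, hx, hy]
    | tmul a m =>
      simp only [he]
      congr 1
      · ext
        exact L.comm i j a
      · exact M.comm i j m
  let P : TModel.{u} n :=
    { carrier := A ⊗[K.carrier] M.carrier, fieldInst := hfield.toField, aut := e, comm := hcomm }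
  let iA : A →+* P.carrier :=
    (Algebra.TensorProduct.includeLeft : A →ₐ[K.carrier] A ⊗[K.carrier] M.carrier).toRingHom
  let iM : M.carrier →+* P.carrier :=
    (Algebra.TensorProduct.includeRight : _ →ₐ[K.carrier] A ⊗[K.carrier] M.carrier).toRingHom
  have hi : ∀ x, iA (algebraMap K.carrier A x) = iM (g x) := fun x =>
    ((Algebra.TensorProduct.includeLeft : A →ₐ[K.carrier] A ⊗[K.carrier] M.carrier).commutes x).trans
    ((Algebra.TensorProduct.includeRight : _ →ₐ[K.carrier] A ⊗[K.carrier] M.carrier).commutes x).symm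
  have hiM : IsTEmb M P iM := by
    intro i x
    have h := he i 1 x
    rw [map_one] at h
    exact h.symm
  obtain ⟨q, hq, hbq⟩ := hb
  let b' : A := ⟨b, (hA b).2 ⟨q, hq, hbq⟩⟩
  have hb' : Polynomial.eval₂ (algebraMap K.carrier A) b' q = 0 := by
    apply (algebraMap A L.carrier).injective
    rw [Polynomial.hom_eval₂, map_zero]
    exact hbq
  have hc : iA.comp (algebraMap K.carrier A) = iM.comp g := RingHom.ext hi
  have hr : Polynomial.eval₂ (iM.comp g) (iA b') q = 0 := by
    rw [← hc, ← Polynomial.hom_eval₂, hb', map_zero]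
  obtain ⟨m, hm⟩ := hM P iM hiM (iA b')
    ⟨q.map g, (Polynomial.map_ne_zero_iff g.injective).2 hq, by
      rw [Polynomial.eval₂_map, hr]⟩
  obtain ⟨k, rfl⟩ := hrel m ⟨q, hq, by
    apply iM.injective
    rw [Polynomial.hom_eval₂, hm, hr, map_zero]⟩
  rw [← hi] at hm
  exact ⟨k, congrArg Subtype.val (iA.injective hm)⟩

/-- if `M` is a relatively algebraically closed model of `T`, `A ⊆ M`,
and `N = acl_σ^M(A)` (the smallest subfield of `M` containing `A`, closed under the
distinguished automorphisms and their inverses, and relatively algebraically closed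
in `M`), then `N`, equipped with the restricted automorphisms, is itself a relatively
algebraically closed model of `T`. -/
theorem aclSigma_is_rac_model {n : ℕ} (hn : 1 ≤ n) (M : TModel.{u} n) (hM : IsRAC M)
    (A : Set M.carrier) (N : Subfield M.carrier)
    (hN : IsSigmaClosed M A N)
    (hmin : ∀ N' : Subfield M.carrier, IsSigmaClosed M A N' → N ≤ N') :
    ∃ (τ : Fin n → (↥N ≃+* ↥N)) (hco : ∀ i j x, τ i (τ j x) = τ j (τ i x)),
      (∀ i (x : ↥N), ((τ i x : ↥N) : M.carrier) = M.aut i ↑x) ∧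
      IsRAC (TModel.mk ↥N τ hco) := by
  have hco : ∀ i j (x : N),
      restrictEquiv N (M.aut i) (hN.2.1 i) (hN.2.2.1 i)
        (restrictEquiv N (M.aut j) (hN.2.1 j) (hN.2.2.1 j) x) =
      restrictEquiv N (M.aut j) (hN.2.1 j) (hN.2.2.1 j)
        (restrictEquiv N (M.aut i) (hN.2.1 i) (hN.2.2.1 i) x) := by
    intro i j x
    ext
    exact M.comm i j x
  refine ⟨fun i => restrictEquiv N (M.aut i) (hN.2.1 i) (hN.2.2.1 i), hco, fun i x => rfl, ?_⟩
  refine rac_of_rel_closed _ M hM N.subtype (fun i x => rfl) ?_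
  intro x hx
  exact ⟨⟨x, hN.2.2.2 x hx⟩, rfl⟩
end

section
/- Fix n ≥ 1 and let K0, K1, K2 be relatively algebraically closed models of T, and let e1 : K0 → K1 and e2 : K0 → K2 be embeddings of models of T. Then there exist a relatively algebraically closed model L of T and embeddings of models of T g1 : K1 → L and g2 : K2 → L such that g1 ∘ e1 = g2 ∘ e2 and g1(K1) ∩ g2(K2) = g1(e1(K0)) (disjoint amalgamation). -/
universe u

open TensorProduct Polynomial

lemma aux_irred {K E : Type*} [Field K] [Field E] [Algebra K E]
    (h : ∀ x : E, IsIntegral K x → x ∈ (algebraMap K E).range)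
    (p : K[X]) (hp : Irreducible p) (hm : p.Monic) : Irreducible (p.map (algebraMap K E)) := by
  have hlift : ∀ q : E[X], q.Monic → q ∣ p.map (algebraMap K E) →
      ∃ q' : K[X], q'.map (algebraMap K E) = q := by
    intro q hq hd
    rw [← Polynomial.mem_lifts, Polynomial.lifts_iff_coeff_lifts]
    intro i
    exact h _ (Polynomial.isIntegral_coeff_of_dvd p q hm hq hd i)
  have hp1 : p.map (algebraMap K E) ≠ 1 := by
    intro h1
    apply hp.not_isUnit
    have : p = 1 := by
      apply Polynomial.map_injective _ (algebraMap K E).injective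
      simpa using h1
    simp [this]
  rw [(hm.map _).irreducible_iff_natDegree]
  refine ⟨hp1, ?_⟩
  intro f g hf hg hfg
  obtain ⟨f', rfl⟩ := hlift f hf ⟨g, hfg.symm⟩
  obtain ⟨g', rfl⟩ := hlift g hg ⟨_, by rw [mul_comm]; exact hfg.symm⟩
  have hfg' : f' * g' = p := by
    apply Polynomial.map_injective _ (algebraMap K E).injective
    simpa using hfg
  rcases hp.isUnit_or_isUnit hfg'.symm with hu | hu
  · left; simpa using Polynomial.natDegree_eq_zero_of_isUnit hu
  · right; simpa using Polynomial.natDegree_eq_zero_of_isUnit hu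

lemma aux_prime {R S : Type*} [CommRing R] [CommRing S] (e : R ≃+* S) (q : R[X])
    (h : Prime (q.map (e : R →+* S))) : Prime q := by
  have := (MulEquiv.prime_iff (Polynomial.mapEquiv e) (p := q)).mp
  exact this (by simpa using h)

lemma aux_fin {K E F : Type*} [Field K] [Field E] [Algebra K E] [Field F] [Algebra K F]
    [PerfectField K] [FiniteDimensional K F]
    (h : ∀ x : E, IsIntegral K x → x ∈ (algebraMap K E).range) :
    IsDomain (E ⊗[K] F) := by
  let pb := Field.powerBasisOfFiniteOfSeparable K F
  have hint : IsIntegral K pb.gen := pb.isIntegral_gen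
  let p := minpoly K pb.gen
  have hirr := aux_irred h p (minpoly.irreducible hint) (minpoly.monic hint)
  let e : AdjoinRoot p ≃ₐ[K] F := AdjoinRoot.equiv' p pb (by simp [p]) (by simp [p])
  let q : (E ⊗[K] K)[X] := p.map (Algebra.TensorProduct.includeRight : K →ₐ[K] E ⊗[K] K).toRingHom
  let e2 := AdjoinRoot.tensorAlgEquiv (R := K) (T := E) p q rfl
  have hq : Prime q := by
    apply aux_prime (Algebra.TensorProduct.rid K K E).toRingEquiv
    have : q.map ((Algebra.TensorProduct.rid K K E).toRingEquiv : E ⊗[K] K →+* E) =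
        p.map (algebraMap K E) := by
      simp only [q, Polynomial.map_map]
      congr 1
      ext x
      simp [Algebra.smul_def]
    rw [this]
    exact hirr.prime
  have := AdjoinRoot.isDomain_of_prime hq
  exact ((Algebra.TensorProduct.congr (AlgEquiv.refl : E ≃ₐ[K] E) e.symm).toMulEquiv.trans
    e2.toMulEquiv).isDomain

lemma aux_step {K E D Q ι : Type*} [Field K] [Field E] [Algebra K E] [CommRing D] [Algebra K D]
    [Field Q] [Algebra K Q] [PerfectField K] [FiniteDimensional K Q] [DecidableEq ι]
    (h : ∀ x : E, IsIntegral K x → x ∈ (algebraMap K E).range) (f : D →ₐ[K] Q)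
    (b : Module.Basis ι K E) (x y : E ⊗[K] D) (hxy : x * y = 0) (i j : ι) :
    f (TensorProduct.equivFinsuppOfBasisLeft b x i) = 0 ∨
      f (TensorProduct.equivFinsuppOfBasisLeft b y j) = 0 := by
  have hdom : IsDomain (E ⊗[K] Q) := aux_fin h
  let ψ : E ⊗[K] D →ₐ[K] E ⊗[K] Q := Algebra.TensorProduct.map (AlgHom.id K E) f
  have hnat : ∀ (z : E ⊗[K] D) k, TensorProduct.equivFinsuppOfBasisLeft b (ψ z) k =
      f (TensorProduct.equivFinsuppOfBasisLeft b z k) := by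
    intro z k
    induction z using TensorProduct.induction_on with
    | zero => simp
    | add z w hz hw => simp [hz, hw]
    | tmul e d => simp [ψ]
  have h0 : ψ x * ψ y = 0 := by rw [← map_mul, hxy, map_zero]
  rcases mul_eq_zero.mp h0 with h0 | h0
  · left; rw [← hnat, h0]; simp
  · right; rw [← hnat, h0]; simp

lemma aux_dom {K E F : Type*} [Field K] [Field E] [Algebra K E] [Field F] [Algebra K F]
    [PerfectField K]
    (h : ∀ x : E, IsIntegral K x → x ∈ (algebraMap K E).range) :
    IsDomain (E ⊗[K] F) := by
  classical
  have hfg : ∀ D : Subalgebra K F, D.FG → NoZeroDivisors (E ⊗[K] D) := by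
    intro D hD
    have hft : Algebra.FiniteType K D := D.fg_iff_finiteType.mp hD
    have hJ : IsJacobsonRing D := isJacobsonRing_of_finiteType (A := K)
    let b := Module.Basis.ofVectorSpace K E
    refine ⟨?_⟩
    intro x y hxy
    by_contra! hne
    obtain ⟨hx, hy⟩ := hne
    have hcoord : ∀ z : E ⊗[K] D, z ≠ 0 →
        ∃ i, TensorProduct.equivFinsuppOfBasisLeft b z i ≠ 0 := by
      intro z hz
      by_contra! h0
      apply hz
      apply (TensorProduct.equivFinsuppOfBasisLeft b).injective
      ext i
      simp [h0]
    obtain ⟨i, hi⟩ := hcoord x hx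
    obtain ⟨j, hj⟩ := hcoord y hy
    have hjac : (⊥ : Ideal D).jacobson = ⊥ :=
      hJ.out (Ideal.IsPrime.isRadical Ideal.isPrime_bot)
    obtain ⟨m, hm, hnm⟩ : ∃ m : Ideal D, m.IsMaximal ∧
        TensorProduct.equivFinsuppOfBasisLeft b x i *
          TensorProduct.equivFinsuppOfBasisLeft b y j ∉ m := by
      by_contra! hall
      apply mul_ne_zero hi hj
      rw [← Ideal.mem_bot, ← hjac, Ideal.jacobson, Submodule.mem_sInf]
      rintro I ⟨-, hI⟩
      exact hall I hI
    let _ : Field (D ⧸ m) := Ideal.Quotient.field m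
    have : Module.Finite K (D ⧸ m) := finite_of_finite_type_of_isJacobsonRing K (D ⧸ m)
    apply hnm
    rcases aux_step h (Ideal.Quotient.mkₐ K m) b x y hxy i j with h0 | h0
    · exact Ideal.mul_mem_right _ _ (Ideal.Quotient.eq_zero_iff_mem.mp h0)
    · exact Ideal.mul_mem_left _ _ (Ideal.Quotient.eq_zero_iff_mem.mp h0)
  have hnt : Nontrivial (E ⊗[K] F) := inferInstance
  have : NoZeroDivisors (E ⊗[K] F) := by
    refine ⟨?_⟩
    intro x y hxy
    obtain ⟨D1, hD1, hx⟩ := exists_fg_and_mem_baseChange x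
    obtain ⟨D2, hD2, hy⟩ := exists_fg_and_mem_baseChange y
    let D := D1 ⊔ D2
    have hD : D.FG := hD1.sup hD2
    have hle : ∀ D' : Subalgebra K F, D' ≤ D → ∀ z ∈ D'.baseChange E,
        ∃ z' : E ⊗[K] D, Algebra.TensorProduct.map (AlgHom.id E E) D.val z' = z := by
      rintro D' hD' z ⟨z', rfl⟩
      refine ⟨Algebra.TensorProduct.map (AlgHom.id E E) (Subalgebra.inclusion hD') z', ?_⟩
      induction z' using TensorProduct.induction_on with
      | zero => simp
      | add z w hz hw => simp only [map_add, hz, hw]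
      | tmul e d => simp
    obtain ⟨x, rfl⟩ := hle D1 le_sup_left x hx
    obtain ⟨y, rfl⟩ := hle D2 le_sup_right y hy
    have h_inj : Function.Injective
        (Algebra.TensorProduct.map (AlgHom.id E E) D.val) :=
      Module.Flat.lTensor_preserves_injective_linearMap _ Subtype.val_injective
    have := hfg D hD
    rw [← map_mul] at hxy
    have hxy' := (map_eq_zero_iff _ h_inj).mp hxy
    rcases mul_eq_zero.mp hxy' with h0 | h0
    · left; rw [h0, map_zero]
    · right; rw [h0, map_zero]
  exact NoZeroDivisors.to_isDomain _

/-- The action of the free group on a model of `T`. -/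
def TModel.act {n : ℕ} (K : TModel.{u} n) : FreeGroup (Fin n) →* RingAut K.carrier :=
  FreeGroup.lift K.aut

lemma TModel.act_of {n : ℕ} (K : TModel.{u} n) (i : Fin n) (x : K.carrier) :
    K.act (FreeGroup.of i) x = K.aut i x := by
  simp [TModel.act]

lemma TModel.act_mul {n : ℕ} (K : TModel.{u} n) (g h : FreeGroup (Fin n)) (x : K.carrier) :
    K.act (g * h) x = K.act g (K.act h x) := by
  rw [map_mul]; rfl

lemma TModel.act_one {n : ℕ} (K : TModel.{u} n) (x : K.carrier) :
    K.act 1 x = x := by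
  rw [map_one]; rfl

lemma TModel.act_nat {n : ℕ} (K L : TModel.{u} n) (f : K.carrier →+* L.carrier)
    (hf : IsTEmb K L f) (g : FreeGroup (Fin n)) (x : K.carrier) :
    f (K.act g x) = L.act g (f x) := by
  induction g using FreeGroup.induction_on generalizing x with
  | C1 => simp [TModel.act_one]
  | of i => rw [K.act_of, L.act_of]; exact hf i x
  | inv_of i _ =>
    apply (L.act (FreeGroup.of i)).injective
    rw [← L.act_mul, mul_inv_cancel, L.act_one, L.act_of, ← hf, ← K.act_of, ← K.act_mul,
      mul_inv_cancel, K.act_one]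
  | mul g h hg hh => rw [K.act_mul, L.act_mul, hg, hh]

/-- Shifting functions on the free group. -/
def shiftEquiv (n : ℕ) (Ω : Type u) [Field Ω] (h : FreeGroup (Fin n)) :
    (FreeGroup (Fin n) → Ω) ≃+* (FreeGroup (Fin n) → Ω) where
  toFun x g := x (g * h)
  invFun x g := x (g * h⁻¹)
  left_inv x := by ext g; simp
  right_inv x := by ext g; simp
  map_mul' x y := rfl
  map_add' x y := rfl

lemma shiftEquiv_apply (n : ℕ) (Ω : Type u) [Field Ω] (h : FreeGroup (Fin n))
    (x : FreeGroup (Fin n) → Ω) (g) : shiftEquiv n Ω h x g = x (g * h) := rfl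

lemma shiftEquiv_symm_apply (n : ℕ) (Ω : Type u) [Field Ω] (h : FreeGroup (Fin n))
    (x : FreeGroup (Fin n) → Ω) (g) : (shiftEquiv n Ω h).symm x g = x (g * h⁻¹) := rfl

/-- Embedding of a model in the coinduced ring. -/
def TModel.emb {n : ℕ} (K : TModel.{u} n) {Ω : Type u} [Field Ω] (φ : K.carrier →+* Ω) :
    K.carrier →+* (FreeGroup (Fin n) → Ω) :=
  RingHom.pi fun g => φ.comp (K.act g : K.carrier ≃+* K.carrier).toRingHom

lemma TModel.emb_apply {n : ℕ} (K : TModel.{u} n) {Ω : Type u} [Field Ω] (φ : K.carrier →+* Ω)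
    (x : K.carrier) (g) : K.emb φ x g = φ (K.act g x) := rfl

lemma TModel.emb_aut {n : ℕ} (K : TModel.{u} n) {Ω : Type u} [Field Ω] (φ : K.carrier →+* Ω)
    (i : Fin n) (x : K.carrier) :
    K.emb φ (K.aut i x) = shiftEquiv n Ω (FreeGroup.of i) (K.emb φ x) := by
  ext g
  rw [shiftEquiv_apply, K.emb_apply, K.emb_apply, K.act_mul, K.act_of]

/-- Subrings of the coinduced ring which are submodels of `T`. -/
structure GoodSub {n : ℕ} {Ω : Type u} [Field Ω] (B : Subring (FreeGroup (Fin n) → Ω)) : Prop where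
  inv : ∀ x ∈ B, x ≠ 0 → ∃ y ∈ B, x * y = 1
  sh : ∀ i, ∀ x ∈ B, shiftEquiv n Ω (FreeGroup.of i) x ∈ B
  shs : ∀ i, ∀ x ∈ B, (shiftEquiv n Ω (FreeGroup.of i)).symm x ∈ B
  comm : ∀ i j, ∀ x ∈ B, shiftEquiv n Ω (FreeGroup.of i) (shiftEquiv n Ω (FreeGroup.of j) x) =
    shiftEquiv n Ω (FreeGroup.of j) (shiftEquiv n Ω (FreeGroup.of i) x)

lemma goodSub_emb {n : ℕ} (K : TModel.{u} n) {Ω : Type u} [Field Ω] (φ : K.carrier →+* Ω) :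
    GoodSub (K.emb φ).range := by
  refine ⟨?_, ?_, ?_, ?_⟩
  · rintro _ ⟨x, rfl⟩ hx
    have hx0 : x ≠ 0 := by rintro rfl; exact hx (map_zero _)
    exact ⟨K.emb φ x⁻¹, ⟨_, rfl⟩, by rw [← map_mul, mul_inv_cancel₀ hx0, map_one]⟩
  · rintro i _ ⟨x, rfl⟩
    exact ⟨K.aut i x, K.emb_aut φ i x⟩
  · rintro i _ ⟨x, rfl⟩
    refine ⟨(K.aut i).symm x, ?_⟩
    rw [RingEquiv.eq_symm_apply, ← K.emb_aut, RingEquiv.apply_symm_apply]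
  · rintro i j _ ⟨x, rfl⟩
    rw [← K.emb_aut, ← K.emb_aut, ← K.emb_aut, ← K.emb_aut, K.comm]

lemma exists_model_of_good {n : ℕ} {Ω : Type u} [Field Ω]
    (B : Subring (FreeGroup (Fin n) → Ω)) (hB : GoodSub B) :
    ∃ (N : TModel.{u} n) (ι : N.carrier →+* (FreeGroup (Fin n) → Ω)),
      ι.range = B ∧ ∀ i x, ι (N.aut i x) = shiftEquiv n Ω (FreeGroup.of i) (ι x) := by
  have hF : IsField B := by
    refine ⟨⟨0, 1, zero_ne_one⟩, mul_comm, ?_⟩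
    rintro ⟨x, hx⟩ h
    obtain ⟨y, hy, hxy⟩ := hB.inv x hx (fun h0 => h (Subtype.ext h0))
    exact ⟨⟨y, hy⟩, Subtype.ext hxy⟩
  let σ : Fin n → B ≃+* B := fun i =>
    { toFun := fun x => ⟨_, hB.sh i x.1 x.2⟩
      invFun := fun x => ⟨_, hB.shs i x.1 x.2⟩
      left_inv := fun x => Subtype.ext ((shiftEquiv n Ω (FreeGroup.of i)).symm_apply_apply x.1)
      right_inv := fun x => Subtype.ext ((shiftEquiv n Ω (FreeGroup.of i)).apply_symm_apply x.1)
      map_mul' := fun x y => Subtype.ext (map_mul (shiftEquiv n Ω (FreeGroup.of i)) x.1 y.1)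
      map_add' := fun x y => Subtype.ext (map_add (shiftEquiv n Ω (FreeGroup.of i)) x.1 y.1) }
  let N : TModel.{u} n :=
    { carrier := B
      fieldInst := hF.toField
      aut := σ
      comm := fun i j x => Subtype.ext (hB.comm i j x.1 x.2) }
  exact ⟨N, B.subtype, B.range_subtype, fun i x => rfl⟩

/-- The subring version of a submodel. -/
lemma exists_submodel {n : ℕ} (L : TModel.{u} n) (C : Subfield L.carrier)
    (h : ∀ i, ∀ x ∈ C, L.aut i x ∈ C) (hs : ∀ i, ∀ x ∈ C, (L.aut i).symm x ∈ C) :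
    ∃ (N : TModel.{u} n) (ι : N.carrier →+* L.carrier), ι.fieldRange = C ∧ IsTEmb N L ι := by
  let σ : Fin n → C ≃+* C := fun i =>
    { toFun := fun x => ⟨_, h i x.1 x.2⟩
      invFun := fun x => ⟨_, hs i x.1 x.2⟩
      left_inv := fun x => Subtype.ext ((L.aut i).symm_apply_apply x.1)
      right_inv := fun x => Subtype.ext ((L.aut i).apply_symm_apply x.1)
      map_mul' := fun x y => Subtype.ext (map_mul (L.aut i) x.1 y.1)
      map_add' := fun x y => Subtype.ext (map_add (L.aut i) x.1 y.1) }
  let N : TModel.{u} n :=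
    { carrier := C
      aut := σ
      comm := fun i j x => Subtype.ext (L.comm i j x.1) }
  exact ⟨N, C.subtype, C.fieldRange_subtype, fun i x => rfl⟩

/-- The relative algebraic closure of a submodel is a submodel. -/
lemma exists_alg_submodel {n : ℕ} (K L : TModel.{u} n) (f : K.carrier →+* L.carrier)
    (hf : IsTEmb K L f) :
    ∃ (N : TModel.{u} n) (ι : N.carrier →+* L.carrier) (f' : K.carrier →+* N.carrier),
      IsTEmb N L ι ∧ IsTEmb K N f' ∧ ι.comp f' = f ∧
      (∀ b : L.carrier, (∃ p : Polynomial K.carrier, p ≠ 0 ∧ Polynomial.eval₂ f b p = 0) →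
        b ∈ ι.range) ∧
      ∀ c : N.carrier, ∃ p : Polynomial K.carrier, p ≠ 0 ∧ Polynomial.eval₂ f' c p = 0 := by
  let _ : Algebra K.carrier L.carrier := f.toAlgebra
  let C : Subfield L.carrier := (algebraicClosure K.carrier L.carrier).toSubfield
  have hC : ∀ b, b ∈ C ↔ ∃ p : Polynomial K.carrier, p ≠ 0 ∧ Polynomial.eval₂ f b p = 0 := by
    intro b
    exact mem_algebraicClosure_iff
  have key : ∀ (s : K.carrier ≃+* K.carrier) (t : L.carrier ≃+* L.carrier),
      (∀ x, f (s x) = t (f x)) → ∀ x ∈ C, t x ∈ C := by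
    intro s t hst x hx
    rw [hC] at hx ⊢
    obtain ⟨p, hp, hpx⟩ := hx
    refine ⟨p.map (s : K.carrier →+* K.carrier), ?_, ?_⟩
    · rwa [Ne, Polynomial.map_eq_zero]
    · rw [Polynomial.eval₂_map]
      have : f.comp (s : K.carrier →+* K.carrier) = (t : L.carrier →+* L.carrier).comp f := by
        ext x; exact hst x
      rw [this]
      have := Polynomial.hom_eval₂ p f (t : L.carrier →+* L.carrier) x
      rw [hpx, map_zero] at this
      exact this.symm
  obtain ⟨N, ι, hι, hιL⟩ := exists_submodel L C
    (fun i => key (K.aut i) (L.aut i) (hf i))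
    (fun i => key (K.aut i).symm (L.aut i).symm (fun x => by
      rw [RingEquiv.eq_symm_apply, ← hf, RingEquiv.apply_symm_apply]))
  have hmem : ∀ b, b ∈ C ↔ ∃ c, ι c = b := by
    intro b; rw [← hι]; exact Iff.rfl
  have hfC : ∀ x, ∃ c, ι c = f x := by
    intro x
    rw [← hmem, hC]
    exact ⟨Polynomial.X - Polynomial.C x, Polynomial.X_sub_C_ne_zero x, by simp⟩
  choose k hk using hfC
  let f' : K.carrier →+* N.carrier :=
    { toFun := k
      map_one' := ι.injective (by rw [hk]; simp)
      map_mul' := fun x y => ι.injective (by rw [hk, map_mul, map_mul, hk, hk])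
      map_zero' := ι.injective (by rw [hk]; simp)
      map_add' := fun x y => ι.injective (by rw [hk, map_add, map_add, hk, hk]) }
  have hff : ι.comp f' = f := by ext x; exact hk x
  refine ⟨N, ι, f', hιL, ?_, hff, ?_, ?_⟩
  · intro i x
    apply ι.injective
    rw [hιL]
    exact (hk _).trans ((hf i x).trans (congrArg _ (hk x).symm))
  · intro b hb
    obtain ⟨c, hc⟩ := (hmem b).mp ((hC b).mpr hb)
    exact ⟨c, hc⟩
  · intro c
    obtain ⟨p, hp, hpc⟩ := (hC (ι c)).mp ((hmem _).mpr ⟨c, rfl⟩)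
    refine ⟨p, hp, ?_⟩
    apply ι.injective
    rw [Polynomial.hom_eval₂, hff, hpc, map_zero]

lemma exists_lift_alg {K N Ω : Type u} [Field K] [Field N] [Field Ω] [IsAlgClosed Ω]
    (f : K →+* N) (h : ∀ c : N, ∃ p : Polynomial K, p ≠ 0 ∧ Polynomial.eval₂ f c p = 0)
    (φ : K →+* Ω) : ∃ ψ : N →+* Ω, ψ.comp f = φ := by
  let _ : Algebra K N := f.toAlgebra
  let _ : Algebra K Ω := φ.toAlgebra
  have : Algebra.IsAlgebraic K N := ⟨fun c => h c⟩
  let ψ : N →ₐ[K] Ω := IsAlgClosed.lift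
  exact ⟨ψ.toRingHom, RingHom.ext fun x => ψ.commutes x⟩

/-- Every model embeds in a relatively algebraically closed model. -/
lemma exists_rac {n : ℕ} (M : TModel.{u} n) :
    ∃ (L : TModel.{u} n) (g : M.carrier →+* L.carrier), IsRAC L ∧ IsTEmb M L g := by
  let Ω := AlgebraicClosure M.carrier
  let φ : M.carrier →+* Ω := algebraMap _ _
  obtain ⟨B, hMB, hmax⟩ := zorn_le_nonempty₀
    {B : Subring (FreeGroup (Fin n) → Ω) | GoodSub B} (by
      intro c hc hchain y hy
      have hmem : ∀ x, x ∈ sSup c ↔ ∃ s ∈ c, x ∈ s := fun x =>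
        Subring.mem_sSup_of_directedOn ⟨y, hy⟩ hchain.directedOn
      refine ⟨sSup c, ⟨?_, ?_, ?_, ?_⟩, fun z hz => le_sSup hz⟩
      · intro x hx h0
        obtain ⟨s, hs, hxs⟩ := (hmem x).mp hx
        obtain ⟨y, hys, hxy⟩ := (hc hs).inv x hxs h0
        exact ⟨y, (hmem y).mpr ⟨s, hs, hys⟩, hxy⟩
      · intro i x hx
        obtain ⟨s, hs, hxs⟩ := (hmem x).mp hx
        exact (hmem _).mpr ⟨s, hs, (hc hs).sh i x hxs⟩
      · intro i x hx
        obtain ⟨s, hs, hxs⟩ := (hmem x).mp hx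
        exact (hmem _).mpr ⟨s, hs, (hc hs).shs i x hxs⟩
      · intro i j x hx
        obtain ⟨s, hs, hxs⟩ := (hmem x).mp hx
        exact (hc hs).comm i j x hxs)
    (M.emb φ).range (goodSub_emb M φ)
  obtain ⟨N, ι, hι, hισ⟩ := exists_model_of_good B hmax.1
  have hιact : ∀ g x h, ι (N.act g x) h = ι x (h * g) := by
    intro g
    induction g using FreeGroup.induction_on with
    | C1 => simp [TModel.act_one]
    | of i => intro x h; rw [N.act_of, hισ, shiftEquiv_apply]
    | inv_of i _ =>
      intro x h
      have := hισ i (N.act (FreeGroup.of i)⁻¹ x)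
      rw [← N.act_of, ← N.act_mul, mul_inv_cancel, N.act_one] at this
      rw [this, shiftEquiv_apply]; simp
    | mul g k hg hk => intro x h; rw [N.act_mul, hg, hk, mul_assoc]
  let ev : N.carrier →+* Ω := (Pi.evalRingHom (fun _ : FreeGroup (Fin n) => Ω) 1).comp ι
  have hemb : N.emb ev = ι := by
    ext x g
    rw [N.emb_apply]
    change ι (N.act g x) 1 = _
    rw [hιact, one_mul]
  have hmemB : ∀ x, (∃ c, ι c = x) ↔ x ∈ B := by
    intro x; rw [← hι]; exact Iff.rfl
  have hgM : ∀ x, ∃ c, ι c = M.emb φ x := fun x => (hmemB _).mpr (hMB ⟨x, rfl⟩)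
  choose k hk using hgM
  have hιinj : Function.Injective ι := ι.injective
  let g : M.carrier →+* N.carrier :=
    { toFun := k
      map_one' := hιinj (by rw [hk]; simp)
      map_mul' := fun x y => hιinj (by rw [hk, map_mul, map_mul, hk, hk])
      map_zero' := hιinj (by rw [hk]; simp)
      map_add' := fun x y => hιinj (by rw [hk, map_add, map_add, hk, hk]) }
  refine ⟨N, g, ?_, ?_⟩
  · intro L f hf b hb
    obtain ⟨P, κ, f', hκ, hf', hκf, hbκ, hPalg⟩ := exists_alg_submodel N L f hf
    obtain ⟨ψ, hψ⟩ := exists_lift_alg f' hPalg ev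
    have hcomp : ∀ x, P.emb ψ (f' x) = ι x := by
      intro x
      rw [← hemb]
      ext g
      rw [P.emb_apply, N.emb_apply, ← TModel.act_nat N P f' hf', ← hψ]; rfl
    have hle : B ≤ (P.emb ψ).range := by
      intro x hx
      obtain ⟨c, rfl⟩ := (hmemB x).mpr hx
      exact ⟨f' c, hcomp c⟩
    have hge := hmax.2 (goodSub_emb P ψ) hle
    obtain ⟨c, rfl⟩ := hbκ b hb
    obtain ⟨d, hd⟩ := (hmemB _).mpr (hge ⟨c, rfl⟩)
    have hdc : f' d = c := by
      apply (P.emb ψ).injective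
      rw [hcomp, hd]
    exact ⟨d, by rw [← hκf, ← hdc]; rfl⟩
  · intro i x
    apply hιinj
    rw [hισ]
    change ι (k _) = shiftEquiv n Ω _ (ι (k x))
    rw [hk, hk, M.emb_aut]

lemma perfect_of_rac {n : ℕ} (K : TModel.{u} n) (h : IsRAC K) : PerfectField K.carrier := by
  obtain ⟨p, hp⟩ := ExpChar.exists K.carrier
  have : PerfectRing K.carrier p := by
    apply PerfectRing.ofSurjective
    intro b
    refine h K (frobenius K.carrier p) ?_ b ⟨Polynomial.X ^ p - Polynomial.C b, ?_, ?_⟩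
    · intro i x
      simp [frobenius_def]
    · exact Polynomial.X_pow_sub_C_ne_zero (expChar_pos K.carrier p) b
    · simp [frobenius_def]
  exact PerfectRing.toPerfectField K.carrier p

/-- The tensor product as a pushout. -/
lemma exists_pushout {A B C : Type u} [Field A] [Field B] [Field C] [PerfectField A]
    (e : A →+* B) (f : A →+* C)
    (h : ∀ (x : B) (p : Polynomial A), p ≠ 0 → Polynomial.eval₂ e x p = 0 → x ∈ e.range) :
    ∃ (P : Type u) (_ : CommRing P) (_ : IsDomain P) (i : B →+* P) (j : C →+* P),
      i.comp e = j.comp f ∧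
      (∀ b c, i b = j c → b ∈ e.range) ∧
      (∀ (S : Type u) [CommRing S] (v : B →+* S) (w : C →+* S), v.comp e = w.comp f →
        ∃ t : P →+* S, t.comp i = v ∧ t.comp j = w) ∧
      (∀ (S : Type u) [CommRing S] (t t' : P →+* S), t.comp i = t'.comp i →
        t.comp j = t'.comp j → t = t') := by
  let _ : Algebra A B := e.toAlgebra
  let _ : Algebra A C := f.toAlgebra
  have hdom : IsDomain (B ⊗[A] C) := by
    apply aux_dom
    rintro x ⟨p, hp, hpx⟩
    exact h x p hp.ne_zero hpx
  refine ⟨B ⊗[A] C, inferInstance, hdom,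
    (Algebra.TensorProduct.includeLeft : B →ₐ[A] B ⊗[A] C).toRingHom,
    (Algebra.TensorProduct.includeRight : C →ₐ[A] B ⊗[A] C).toRingHom, ?_, ?_, ?_, ?_⟩
  · ext x
    exact (Algebra.TensorProduct.includeLeft : B →ₐ[A] B ⊗[A] C).commutes x |>.trans
      ((Algebra.TensorProduct.includeRight : C →ₐ[A] B ⊗[A] C).commutes x).symm
  · intro b c hbc
    have hbc' : (b ⊗ₜ[A] (1 : C)) = (1 : B) ⊗ₜ[A] c := hbc
    obtain ⟨l, hl⟩ := Module.Projective.exists_dual_ne_zero A (one_ne_zero : (1 : C) ≠ 0)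
    have := congrArg (TensorProduct.rid A B ∘ LinearMap.lTensor B l) hbc'
    simp only [Function.comp, LinearMap.lTensor_tmul, TensorProduct.rid_tmul] at this
    refine ⟨(l 1)⁻¹ * l c, ?_⟩
    have h2 : e (l 1) * b = e (l c) * 1 := this
    have h3 : e (l 1) ≠ 0 := by rwa [Ne, map_eq_zero]
    rw [map_mul, map_inv₀, inv_mul_eq_iff_eq_mul₀ h3, h2, mul_one]
  · intro S _ v w hvw
    let _ : Algebra A S := (v.comp e).toAlgebra
    let v' : B →ₐ[A] S := { v with commutes' := fun x => rfl }
    let w' : C →ₐ[A] S := { w with commutes' := fun x => (RingHom.congr_fun hvw x).symm }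
    refine ⟨(Algebra.TensorProduct.lift v' w' fun _ _ => .all ..).toRingHom, ?_, ?_⟩
    · ext x
      change (Algebra.TensorProduct.lift v' w' fun _ _ => .all ..) (x ⊗ₜ 1) = v x
      simp [v']
    · ext x
      change (Algebra.TensorProduct.lift v' w' fun _ _ => .all ..) (1 ⊗ₜ x) = w x
      simp [w']
  · intro S _ t t' h1 h2
    refine RingHom.ext fun x => ?_
    induction x using TensorProduct.induction_on with
    | zero => simp
    | add x y hx hy => rw [map_add, map_add, hx, hy]
    | tmul b c =>
      have : b ⊗ₜ[A] c = (b ⊗ₜ[A] (1 : C)) * ((1 : B) ⊗ₜ[A] c) := by simp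
      rw [this, map_mul, map_mul]
      congr 1
      · exact RingHom.congr_fun h1 b
      · exact RingHom.congr_fun h2 c

/-- disjoint amalgamation for relatively algebraically closed models of
`T`: given embeddings `e1 : K0 → K1`, `e2 : K0 → K2` of models of `T` between
relatively algebraically closed models, there are a relatively algebraically closed
model `L` of `T` and embeddings `g1 : K1 → L`, `g2 : K2 → L` of models of `T` with
`g1 ∘ e1 = g2 ∘ e2` and `g1(K1) ∩ g2(K2) = g1(e1(K0))`. -/
theorem disjoint_amalgamation {n : ℕ} (hn : 1 ≤ n)
    (K0 K1 K2 : TModel.{u} n) (h0 : IsRAC K0) (h1 : IsRAC K1) (h2 : IsRAC K2)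
    (e1 : K0.carrier →+* K1.carrier) (he1 : IsTEmb K0 K1 e1)
    (e2 : K0.carrier →+* K2.carrier) (he2 : IsTEmb K0 K2 e2) :
    ∃ (L : TModel.{u} n), IsRAC L ∧
      ∃ (g1 : K1.carrier →+* L.carrier) (g2 : K2.carrier →+* L.carrier),
        IsTEmb K1 L g1 ∧ IsTEmb K2 L g2 ∧
        g1.comp e1 = g2.comp e2 ∧
        g1.range ⊓ g2.range = (g1.comp e1).range := by
  have := perfect_of_rac K0 h0
  obtain ⟨P, _, _, i, j, hij, hdisj, hlift, hext⟩ := exists_pushout e1 e2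
    (fun x p hp hpx => h0 K1 e1 he1 x ⟨p, hp, hpx⟩)
  -- maps on the pushout
  have hmap : ∀ (s0 : K0.carrier ≃+* K0.carrier) (s1 : K1.carrier ≃+* K1.carrier)
      (s2 : K2.carrier ≃+* K2.carrier), (∀ x, e1 (s0 x) = s1 (e1 x)) →
      (∀ x, e2 (s0 x) = s2 (e2 x)) →
      ∃ t : P →+* P, (∀ x, t (i x) = i (s1 x)) ∧ ∀ x, t (j x) = j (s2 x) := by
    intro s0 s1 s2 hs1 hs2
    obtain ⟨t, ht1, ht2⟩ := hlift P (i.comp (s1 : K1.carrier →+* K1.carrier))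
      (j.comp (s2 : K2.carrier →+* K2.carrier)) (by
        ext x
        change i (s1 (e1 x)) = j (s2 (e2 x))
        rw [← hs1, ← hs2]
        exact RingHom.congr_fun hij _)
    exact ⟨t, fun x => RingHom.congr_fun ht1 x, fun x => RingHom.congr_fun ht2 x⟩
  have hex : ∀ t t' : P →+* P, (∀ x, t (i x) = t' (i x)) → (∀ x, t (j x) = t' (j x)) →
      ∀ x, t x = t' x := by
    intro t t' ha hb x
    exact RingHom.congr_fun (hext P t t' (RingHom.ext ha) (RingHom.ext hb)) x
  have haut : ∀ k : Fin n, ∃ t : P ≃+* P, (∀ x, t (i x) = i (K1.aut k x)) ∧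
      ∀ x, t (j x) = j (K2.aut k x) := by
    intro k
    obtain ⟨t, ht1, ht2⟩ := hmap (K0.aut k) (K1.aut k) (K2.aut k) (he1 k) (he2 k)
    obtain ⟨s, hs1, hs2⟩ := hmap (K0.aut k).symm (K1.aut k).symm (K2.aut k).symm
      (fun x => by rw [RingEquiv.eq_symm_apply, ← he1, RingEquiv.apply_symm_apply])
      (fun x => by rw [RingEquiv.eq_symm_apply, ← he2, RingEquiv.apply_symm_apply])
    refine ⟨RingEquiv.ofRingHom t s ?_ ?_, ht1, ht2⟩
    · exact RingHom.ext (hex (t.comp s) (RingHom.id P) (fun x => by simp [hs1, ht1])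
        (fun x => by simp [hs2, ht2]))
    · exact RingHom.ext (hex (s.comp t) (RingHom.id P) (fun x => by simp [hs1, ht1])
        (fun x => by simp [hs2, ht2]))
  choose σ hσ1 hσ2 using haut
  have hcomm : ∀ k l x, σ k (σ l x) = σ l (σ k x) := by
    intro k l
    exact hex ((σ k : P →+* P).comp (σ l : P →+* P)) ((σ l : P →+* P).comp (σ k : P →+* P))
      (fun x => by simp [hσ1, K1.comm k l]) (fun x => by simp [hσ2, K2.comm k l])
  let M : TModel.{u} n :=
    { carrier := FractionRing P
      aut := fun k => IsFractionRing.ringEquivOfRingEquiv (σ k)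
      comm := by
        intro k l x
        obtain ⟨a, b, hb, rfl⟩ := IsFractionRing.div_surjective (A := P) x
        simp [hcomm k l] }
  let q : P →+* M.carrier := algebraMap P (FractionRing P)
  have hq : ∀ k x, q (σ k x) = M.aut k (q x) := fun k x =>
    (IsFractionRing.ringEquivOfRingEquiv_algebraMap (σ k) x).symm
  have hqinj : Function.Injective q := IsFractionRing.injective P (FractionRing P)
  obtain ⟨L, g, hL, hg⟩ := exists_rac M
  refine ⟨L, hL, (g.comp q).comp i, (g.comp q).comp j, ?_, ?_, ?_, ?_⟩
  · intro k x
    change g (q (i (K1.aut k x))) = L.aut k (g (q (i x)))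
    rw [← hσ1, hq, hg]
  · intro k x
    change g (q (j (K2.aut k x))) = L.aut k (g (q (j x)))
    rw [← hσ2, hq, hg]
  · rw [RingHom.comp_assoc, hij]; rfl
  · ext x
    constructor
    · rintro ⟨⟨b, hb⟩, ⟨c, hc⟩⟩
      have hbc : i b = j c := hqinj (g.injective (hb.trans hc.symm))
      obtain ⟨a, rfl⟩ := hdisj b c hbc
      exact ⟨a, hb⟩
    · rintro ⟨a, rfl⟩
      refine ⟨⟨e1 a, rfl⟩, ⟨e2 a, ?_⟩⟩
      exact congrArg (g.comp q) (RingHom.congr_fun hij a).symm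
end

section
/- Fix n ≥ 1. Every model of T embeds, via an embedding of models of T, into a relatively algebraically closed model of T. -/
universe u

/-- A difference subfield of `Ω`, with operators given by total functions with junk values. -/
structure PartT (n : ℕ) (Ω : Type u) [Field Ω] : Type u where
  E : Subfield Ω
  s : Fin n → Ω → Ω
  maps : ∀ i x, x ∈ E → s i x ∈ E
  surj : ∀ i y, y ∈ E → ∃ x ∈ E, s i x = y
  one : ∀ i, s i 1 = 1
  add : ∀ i x y, x ∈ E → y ∈ E → s i (x + y) = s i x + s i y
  mul : ∀ i x y, x ∈ E → y ∈ E → s i (x * y) = s i x * s i y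
  comm : ∀ i j x, x ∈ E → s i (s j x) = s j (s i x)

instance PartT.preorder {n : ℕ} {Ω : Type u} [Field Ω] : Preorder (PartT n Ω) where
  le P Q := P.E ≤ Q.E ∧ ∀ i x, x ∈ P.E → Q.s i x = P.s i x
  le_refl P := ⟨le_rfl, fun _ _ _ => rfl⟩
  le_trans P Q R h1 h2 := ⟨h1.1.trans h2.1, fun i x hx => by
    rw [h2.2 i x (h1.1 hx), h1.2 i x hx]⟩

noncomputable def PartT.hom {n : ℕ} {Ω : Type u} [Field Ω] (P : PartT n Ω) (i : Fin n) :
    P.E →+* P.E where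
  toFun x := ⟨P.s i x, P.maps i x x.2⟩
  map_one' := Subtype.ext (P.one i)
  map_mul' x y := Subtype.ext (P.mul i x y x.2 y.2)
  map_zero' := Subtype.ext (by
    have := P.add i 0 0 P.E.zero_mem P.E.zero_mem
    simpa using this)
  map_add' x y := Subtype.ext (P.add i x y x.2 y.2)

noncomputable def PartT.equiv {n : ℕ} {Ω : Type u} [Field Ω] (P : PartT n Ω) (i : Fin n) :
    P.E ≃+* P.E :=
  RingEquiv.ofBijective (P.hom i) ⟨(P.hom i).injective, fun y => by
    obtain ⟨x, hx, h⟩ := P.surj i y y.2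
    exact ⟨⟨x, hx⟩, Subtype.ext h⟩⟩

noncomputable def PartT.toModel {n : ℕ} {Ω : Type u} [Field Ω] (P : PartT n Ω) : TModel.{u} n where
  carrier := P.E
  aut i := P.equiv i
  comm i j x := Subtype.ext (P.comm i j x x.2)

lemma extend_hom {n : ℕ} {Ω : Type u} [Field Ω] (A : TModel.{u} n) (g : A.carrier →+* Ω)
    (i : Fin n) (a : A.carrier) :
    Function.extend g (fun a => g (A.aut i a)) id (g a) = g (A.aut i a) :=
  g.injective.extend_apply _ _ _

noncomputable def PartT.ofModel {n : ℕ} {Ω : Type u} [Field Ω] (A : TModel.{u} n)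
    (g : A.carrier →+* Ω) : PartT n Ω where
  E := g.fieldRange
  s i := Function.extend g (fun a => g (A.aut i a)) id
  maps := by
    rintro i _ ⟨a, rfl⟩
    rw [extend_hom]; exact ⟨_, rfl⟩
  surj := by
    rintro i _ ⟨a, rfl⟩
    refine ⟨g ((A.aut i).symm a), ⟨_, rfl⟩, ?_⟩
    rw [extend_hom]; simp
  one i := by
    have := extend_hom A g i 1
    simpa using this
  add := by
    rintro i _ _ ⟨a, rfl⟩ ⟨b, rfl⟩
    rw [← map_add, extend_hom, extend_hom, extend_hom]; simp
  mul := by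
    rintro i _ _ ⟨a, rfl⟩ ⟨b, rfl⟩
    rw [← map_mul, extend_hom, extend_hom, extend_hom]; simp
  comm := by
    rintro i j _ ⟨a, rfl⟩
    simp only [extend_hom, A.comm i j]

lemma PartT.chain_bdd {n : ℕ} {Ω : Type u} [Field Ω] (c : Set (PartT n Ω))
    (hc : IsChain (· ≤ ·) c) (P₀ : PartT n Ω) (h0 : P₀ ∈ c) : ∃ U, ∀ P ∈ c, P ≤ U := by
  classical
  let s : Fin n → Ω → Ω := fun i x =>
    if h : ∃ P ∈ c, x ∈ P.E then h.choose.s i x else x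
  have hs : ∀ i, ∀ P ∈ c, ∀ x ∈ P.E, s i x = P.s i x := by
    intro i P hP x hx
    have h : ∃ P ∈ c, x ∈ P.E := ⟨P, hP, hx⟩
    have e : s i x = h.choose.s i x := dif_pos h
    rw [e]
    obtain ⟨h1, h2⟩ := h.choose_spec
    rcases hc.total h1 hP with h3 | h3
    · exact (h3.2 i x h2).symm
    · exact h3.2 i x hx
  have hdir : DirectedOn (· ≤ ·) (PartT.E '' c) := by
    rintro _ ⟨P, hP, rfl⟩ _ ⟨Q, hQ, rfl⟩
    rcases hc.total hP hQ with h | h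
    · exact ⟨_, ⟨Q, hQ, rfl⟩, h.1, le_rfl⟩
    · exact ⟨_, ⟨P, hP, rfl⟩, le_rfl, h.1⟩
  have hmem : ∀ x, x ∈ sSup (PartT.E '' c) ↔ ∃ P ∈ c, x ∈ P.E := by
    intro x
    rw [Subfield.mem_sSup_of_directedOn (Set.Nonempty.image _ ⟨P₀, h0⟩) hdir]
    simp
  have hmem2 : ∀ x y, x ∈ sSup (PartT.E '' c) → y ∈ sSup (PartT.E '' c) →
      ∃ P ∈ c, x ∈ P.E ∧ y ∈ P.E := by
    intro x y hx hy
    obtain ⟨P, hP, hx⟩ := (hmem x).1 hx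
    obtain ⟨Q, hQ, hy⟩ := (hmem y).1 hy
    rcases hc.total hP hQ with h | h
    · exact ⟨Q, hQ, h.1 hx, hy⟩
    · exact ⟨P, hP, hx, h.1 hy⟩
  refine ⟨⟨sSup (PartT.E '' c), s, ?_, ?_, ?_, ?_, ?_, ?_⟩, ?_⟩
  · intro i x hx
    obtain ⟨P, hP, hx⟩ := (hmem x).1 hx
    rw [hs i P hP x hx]
    exact (hmem _).2 ⟨P, hP, P.maps i x hx⟩
  · intro i x hx
    obtain ⟨P, hP, hx⟩ := (hmem x).1 hx
    obtain ⟨y, hy, rfl⟩ := P.surj i x hx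
    exact ⟨y, (hmem _).2 ⟨P, hP, hy⟩, hs i P hP y hy⟩
  · intro i
    rw [hs i P₀ h0 1 P₀.E.one_mem, P₀.one]
  · intro i x y hx hy
    obtain ⟨P, hP, hx, hy⟩ := hmem2 x y hx hy
    rw [hs i P hP _ hx, hs i P hP _ hy, hs i P hP _ (P.E.add_mem hx hy), P.add i x y hx hy]
  · intro i x y hx hy
    obtain ⟨P, hP, hx, hy⟩ := hmem2 x y hx hy
    rw [hs i P hP _ hx, hs i P hP _ hy, hs i P hP _ (P.E.mul_mem hx hy), P.mul i x y hx hy]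
  · intro i j x hx
    obtain ⟨P, hP, hx⟩ := (hmem x).1 hx
    rw [hs i P hP _ hx, hs j P hP _ hx, hs i P hP _ (P.maps j x hx),
      hs j P hP _ (P.maps i x hx), P.comm i j x hx]
  · intro P hP
    exact ⟨fun x hx => (hmem x).2 ⟨P, hP, hx⟩, fun i x hx => hs i P hP x hx⟩

lemma algebraic_transport {F L : Type u} [Field F] [Field L] [Algebra F L]
    (σ : F ≃+* F) (τ : L ≃+* L) (h : ∀ x, τ (algebraMap F L x) = algebraMap F L (σ x))
    (b : L) (hb : IsAlgebraic F b) : IsAlgebraic F (τ b) := by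
  obtain ⟨p, hp, hpb⟩ := hb
  refine ⟨p.map (σ : F →+* F), (Polynomial.map_ne_zero_iff σ.injective).2 hp, ?_⟩
  rw [Polynomial.aeval_def, Polynomial.eval₂_map]
  have e : (algebraMap F L).comp (σ : F →+* F) = (τ : L →+* L).comp (algebraMap F L) :=
    RingHom.ext fun x => (h x).symm
  have := Polynomial.hom_eval₂ p (algebraMap F L) (τ : L →+* L) b
  rw [e]
  rw [Polynomial.aeval_def] at hpb
  rw [hpb] at this
  simpa using this.symm

lemma exists_lift_algClosure (F L Ω : Type u) [Field F] [Field L] [Field Ω] [Algebra F L]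
    [Algebra F Ω] [IsAlgClosed Ω] : Nonempty (algebraicClosure F L →ₐ[F] Ω) :=
  ⟨IsAlgClosed.lift⟩

lemma PartT.isRAC {n : ℕ} {Ω : Type u} [Field Ω] [IsAlgClosed Ω] (P : PartT n Ω)
    (hP : ∀ Q, P ≤ Q → Q ≤ P) : IsRAC P.toModel := by
  intro L f hf b hb
  change P.E →+* L.carrier at f
  let _ : Algebra P.E L.carrier := f.toAlgebra
  have hf' : ∀ i (x : P.E), L.aut i (algebraMap P.E L.carrier x)
      = algebraMap P.E L.carrier (P.equiv i x) := fun i x => (hf i x).symm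
  have hf'' : ∀ i (x : P.E), (L.aut i).symm (algebraMap P.E L.carrier x)
      = algebraMap P.E L.carrier ((P.equiv i).symm x) := fun i x => by
    rw [RingEquiv.symm_apply_eq, hf']
    exact congrArg _ ((P.equiv i).apply_symm_apply x).symm
  let A := algebraicClosure P.E L.carrier
  have m1 : ∀ i, ∀ x ∈ A, L.aut i x ∈ A := fun i x hx => by
    rw [mem_algebraicClosure_iff'] at hx ⊢
    exact (algebraic_transport (P.equiv i) (L.aut i) (hf' i) x hx.isAlgebraic).isIntegral
  have m2 : ∀ i, ∀ x ∈ A, (L.aut i).symm x ∈ A := fun i x hx => by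
    rw [mem_algebraicClosure_iff'] at hx ⊢
    exact (algebraic_transport (P.equiv i).symm (L.aut i).symm (hf'' i) x
      hx.isAlgebraic).isIntegral
  let N : TModel.{u} n :=
    { carrier := A
      aut := fun i =>
        { toFun := fun x => ⟨L.aut i x, m1 i x x.2⟩
          invFun := fun x => ⟨(L.aut i).symm x, m2 i x x.2⟩
          left_inv := fun x => Subtype.ext (by simp)
          right_inv := fun x => Subtype.ext (by simp)
          map_mul' := fun x y => Subtype.ext (by simp)
          map_add' := fun x y => Subtype.ext (by simp) }
      comm := fun i j x => Subtype.ext (L.comm i j x) }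
  obtain ⟨g⟩ : Nonempty (A →ₐ[P.E] Ω) := exists_lift_algClosure P.E L.carrier Ω
  have hg : ∀ x : P.E, g (algebraMap P.E A x) = x := fun x => g.commutes x
  have hle : P ≤ PartT.ofModel N (g : A →+* Ω) := by
    refine ⟨fun x hx => ⟨algebraMap P.E A ⟨x, hx⟩, hg ⟨x, hx⟩⟩, fun i x hx => ?_⟩
    have h1 := extend_hom N (g : A →+* Ω) i (algebraMap P.E A ⟨x, hx⟩)
    have h2 : N.aut i (algebraMap P.E A ⟨x, hx⟩)
        = algebraMap P.E A (P.equiv i ⟨x, hx⟩) := Subtype.ext (hf' i ⟨x, hx⟩)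
    rw [h2] at h1
    have h3 := hg (P.equiv i ⟨x, hx⟩)
    have h4 := hg ⟨x, hx⟩
    change Function.extend _ _ id (g (algebraMap P.E A ⟨x, hx⟩)) =
      g (algebraMap P.E A (P.equiv i ⟨x, hx⟩)) at h1
    rw [h3, h4] at h1
    exact h1
  have hbA : b ∈ A := by
    rw [mem_algebraicClosure_iff']
    obtain ⟨p, hp, hpb⟩ := hb
    exact IsAlgebraic.isIntegral ⟨p, hp, hpb⟩
  have hgb : g ⟨b, hbA⟩ ∈ P.E := (hP _ hle).1 ⟨⟨b, hbA⟩, rfl⟩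
  refine ⟨⟨_, hgb⟩, ?_⟩
  have h5 := g.toRingHom.injective (hg ⟨_, hgb⟩)
  exact congrArg Subtype.val h5

/-- every model of `T` embeds, via an embedding of models of `T`,
into a relatively algebraically closed model of `T`. -/
theorem embeds_into_rac_model {n : ℕ} (hn : 1 ≤ n) (K : TModel.{u} n) :
    ∃ (L : TModel.{u} n) (f : K.carrier →+* L.carrier), IsTEmb K L f ∧ IsRAC L := by
  let Ω := AlgebraicClosure K.carrier
  let g : K.carrier →+* Ω := algebraMap _ _
  obtain ⟨P, h0, hP⟩ := zorn_le_nonempty_Ici₀ (PartT.ofModel K g)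
    (fun c _ hc y hy => by
      obtain ⟨U, hU⟩ := PartT.chain_bdd c hc y hy
      exact ⟨U, hU⟩) _ le_rfl
  refine ⟨P.toModel, g.codRestrict P.E (fun x => h0.1 ⟨x, rfl⟩), ?_,
    PartT.isRAC P fun Q hQ => hP hQ⟩
  intro i x
  apply Subtype.ext
  have h1 := h0.2 i (g x) ⟨x, rfl⟩
  exact ((h1.trans (extend_hom K g i x))).symm
end

section
/- Fix n ≥ 1, let M be a relatively algebraically closed model of T, let a ∈ M be a finite tuple, and let A ⊆ M. Then there exists a finite subset A₀ ⊆ A such that acl_σ^M(A₀ ∪ a) and acl_σ^M(A) are algebraically independent over acl_σ^M(A₀) (finite character of independence). -/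
universe u

/-- The family of subfields of `M` containing `S`, closed under the distinguished
automorphisms and their inverses, and relatively algebraically closed in `M`. -/
def AclFamily {n : ℕ} (M : TModel.{u} n) (S : Set M.carrier) :
    Set (Subfield M.carrier) :=
  {N | S ⊆ N ∧ (∀ i, ∀ x ∈ N, M.aut i x ∈ N) ∧ (∀ i, ∀ x ∈ N, (M.aut i).symm x ∈ N) ∧
    ∀ x : M.carrier,
      (∃ p : Polynomial ↥N, p ≠ 0 ∧ Polynomial.eval₂ N.subtype x p = 0) → x ∈ N}

/-- `acl_σ^M(S)`: the smallest subfield of `M` containing `S`, closed under the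
distinguished automorphisms and their inverses, and relatively algebraically closed
in `M`. -/
def aclSigma {n : ℕ} (M : TModel.{u} n) (S : Set M.carrier) : Subfield M.carrier :=
  sInf (AclFamily M S)

/-- A finite tuple `x` of elements of a field is algebraically independent over a
subfield `k`. -/
def AlgIndepTuple {F : Type u} [Field F] (k : Subfield F) {m : ℕ} (x : Fin m → F) :
    Prop :=
  ∀ p : MvPolynomial (Fin m) ↥k, MvPolynomial.eval₂ k.subtype x p = 0 → p = 0

/-- The subfields `E` and `F'` of a field are algebraically independent over `k`:
every finite tuple from `E` that is algebraically independent over `k` remains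
algebraically independent over `F'`. -/
def FieldAlgIndep {F : Type u} [Field F] (E F' k : Subfield F) : Prop :=
  ∀ (m : ℕ) (x : Fin m → F), (∀ l, x l ∈ E) → AlgIndepTuple k x → AlgIndepTuple F' x


open AlgebraicIndependent

/-- The (relative) algebraic closure of `K(S)` in `F`. -/
def fcCl {F : Type u} [Field F] (K : Subfield F) (S : Set F) : Set F :=
  {x | IsAlgebraic (Algebra.adjoin K S) x}

theorem fcCl_eq {F : Type u} [Field F] (K : Subfield F) (S : Set F) :
    fcCl K S = (matroid K F).closure S := by
  rw [matroid_closure_eq]; rfl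

theorem fcCl_base {F : Type u} [Field F] (K : Subfield F) (S : Set F) :
    (K : Set F) ⊆ fcCl K S := fun x hx =>
  isAlgebraic_algebraMap
    (⟨x, (Algebra.adjoin K S).algebraMap_mem ⟨x, hx⟩⟩ : Algebra.adjoin K S)

theorem fcCl_self {F : Type u} [Field F] (K : Subfield F) (S : Set F) :
    S ⊆ fcCl K S := fun x hx =>
  isAlgebraic_algebraMap (⟨x, Algebra.subset_adjoin hx⟩ : Algebra.adjoin K S)

/-- `fcCl K S` as a subfield. -/
def fcClF {F : Type u} [Field F] (K : Subfield F) (S : Set F) : Subfield F where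
  carrier := fcCl K S
  mul_mem' := fun ha hb => (Subalgebra.algebraicClosure (Algebra.adjoin K S) F).mul_mem ha hb
  one_mem' := (Subalgebra.algebraicClosure (Algebra.adjoin K S) F).one_mem
  add_mem' := fun ha hb => (Subalgebra.algebraicClosure (Algebra.adjoin K S) F).add_mem ha hb
  zero_mem' := (Subalgebra.algebraicClosure (Algebra.adjoin K S) F).zero_mem
  neg_mem' := fun ha => (Subalgebra.algebraicClosure (Algebra.adjoin K S) F).neg_mem ha
  inv_mem' := fun _ ha => IsAlgebraic.inv ha

theorem fc_alg {F : Type u} [Field F] (K : Subfield F) (S : Set F) (x : F)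
    (R : Subring F) (hR : (R : Set F) ⊆ fcCl K S) (hx : IsAlgebraic R x) :
    x ∈ fcCl K S := by
  have h : IsAlgebraic (Subalgebra.algebraicClosure (Algebra.adjoin K S) F) x := by
    refine hx.ringHom_of_comp_eq (S := Subalgebra.algebraicClosure (Algebra.adjoin K S) F)
      (R.subtype.codRestrict (Subalgebra.algebraicClosure (Algebra.adjoin K S) F) (fun r => hR r.2))
      (RingHom.id F) ?_ rfl
    intro a b hab
    have hab' := Subtype.ext_iff.1 hab
    exact Subtype.ext hab'
  exact h.restrictScalars (Algebra.adjoin K S)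

theorem fcCl_sub {F : Type u} [Field F] {K K' : Subfield F} {S T : Set F}
    (hK : (K : Set F) ⊆ fcCl K' T) (hS : S ⊆ fcCl K' T) : fcCl K S ⊆ fcCl K' T := by
  intro x hx
  refine fc_alg K' T x (Algebra.adjoin K S).toSubring ?_ hx
  intro y hy
  change y ∈ fcClF K' T
  have hy' : y ∈ Algebra.adjoin K S := hy
  clear hy
  induction hy' using Algebra.adjoin_induction with
  | mem x hx => exact hS hx
  | algebraMap r => exact hK r.2
  | add x y hx hy h1 h2 => exact add_mem h1 h2
  | mul x y hx hy h1 h2 => exact mul_mem h1 h2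

theorem fcCl_mono {F : Type u} [Field F] {K K' : Subfield F} {S T : Set F}
    (hK : K ≤ K') (hS : S ⊆ T) : fcCl K S ⊆ fcCl K' T :=
  fcCl_sub (fun _ h => fcCl_base _ _ (hK h)) (hS.trans (fcCl_self _ _))

theorem fcCl_equiv {F : Type u} [Field F] {K : Subfield F} {S : Set F} (g : F ≃+* F)
    (hg : ∀ x ∈ K, g x ∈ K) {x : F} (hx : x ∈ fcCl K S) : g x ∈ fcCl K (g '' S) := by
  have key : ∀ y ∈ Algebra.adjoin K S, g y ∈ Algebra.adjoin K (g '' S) := by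
    intro y hy
    induction hy using Algebra.adjoin_induction with
    | mem x hx => exact Algebra.subset_adjoin ⟨x, hx, rfl⟩
    | algebraMap r =>
      exact (Algebra.adjoin K (g '' S)).algebraMap_mem ⟨g r, hg r r.2⟩
    | add x y hx hy h1 h2 => rw [map_add]; exact add_mem h1 h2
    | mul x y hx hy h1 h2 => rw [map_mul]; exact mul_mem h1 h2
  have hx' : IsAlgebraic (Algebra.adjoin K S) x := hx
  refine hx'.ringHom_of_comp_eq (S := Algebra.adjoin K (g '' S))
    (((g : F →+* F).comp (algebraMap (Algebra.adjoin K S) F)).codRestrict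
      (Algebra.adjoin K (g '' S)) (fun r => key r r.2)) (g : F →+* F) ?_ rfl
  intro a b hab
  exact Subtype.ext (g.injective (congrArg Subtype.val hab))

theorem fcCl_finite {F : Type u} [Field F] {K : Subfield F} {S : Set F} {X : Set F}
    (hX : X.Finite) (h : X ⊆ fcCl K S) :
    ∃ Y ⊆ S, Y.Finite ∧ X ⊆ fcCl K Y := by
  choose! Y hY using fun x (hx : x ∈ X) => by
    have := h hx
    rw [fcCl_eq] at this
    exact Matroid.exists_mem_finite_closure_of_mem_closure this
  refine ⟨⋃ x ∈ X, Y x, by simpa using fun x hx => (hY x hx).1,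
    hX.biUnion fun x hx => (hY x hx).2.1, fun x hx => ?_⟩
  rw [fcCl_eq]
  exact Matroid.closure_subset_closure _ (Set.subset_biUnion_of_mem (u := Y) hx) (hY x hx).2.2.2

theorem fcCl_bot {F : Type u} [Field F] {K : Subfield F} {S : Set F} :
    fcCl K S = fcCl ⊥ ((K : Set F) ∪ S) := by
  apply subset_antisymm
  · exact fcCl_sub (Set.subset_union_left.trans (fcCl_self _ _))
      (Set.subset_union_right.trans (fcCl_self _ _))
  · refine fcCl_sub (fun x hx => fcCl_base _ _ ?_)
      (Set.union_subset (fcCl_base _ _) (fcCl_self _ _))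
    exact (bot_le : (⊥ : Subfield F) ≤ K) hx

/-- Transfer of independence. -/
theorem fc_transfer {F : Type u} [Field F] {K K' : Subfield F} (hK : K ≤ K') {B X : Set F}
    (hB : (matroid K' F).Indep B) (hX : (matroid K F).Indep X) (hXf : X.Finite)
    (hXB : X ⊆ fcCl K B) : (matroid K' F).Indep X := by
  obtain ⟨B', hB'B, hB'f, hXB'⟩ := fcCl_finite hXf hXB
  have hB' := hB.subset hB'B
  have hcl : ∀ S, (matroid K F).closure S ⊆ (matroid K' F).closure S := fun S => by
    rw [← fcCl_eq, ← fcCl_eq]; exact fcCl_mono hK le_rfl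
  obtain ⟨Y, hY, hXY⟩ := hX.subset_isBasis_of_subset (Set.subset_union_left (t := B'))
    (Set.subset_univ _)
  refine Matroid.Indep.subset ?_ hXY
  have hYf : Y.Finite := (hXf.union hB'f).subset hY.subset
  rw [fcCl_eq] at hXB'
  have h1 : Y.encard ≤ B'.encard := by
    rw [hY.encard_eq_eRk]
    calc _ ≤ (matroid K F).eRk ((matroid K F).closure B') :=
          Matroid.eRk_mono _ (Set.union_subset hXB' (Matroid.subset_closure _ _ (Set.subset_univ _)))
      _ = (matroid K F).eRk B' := Matroid.eRk_closure_eq _ _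
      _ ≤ _ := Matroid.eRk_le_encard _ _
  have h2 : B'.encard ≤ (matroid K' F).eRk Y := by
    rw [← hB'.eRk_eq_encard, ← Matroid.eRk_closure_eq _ Y]
    apply Matroid.eRk_mono
    exact (Set.subset_union_right.trans hY.subset_closure).trans (hcl _)
  rw [Matroid.indep_iff_eRk_eq_encard_of_finite hYf]
  exact le_antisymm (Matroid.eRk_le_encard _ _) (h1.trans h2)

theorem fc_greedy_indep {F : Type u} [Field F] {K : Subfield F} {J : Type*} [LinearOrder J]
    (f : J → F) :
    (matroid K F).Indep (f '' {j | f j ∉ fcCl K (f '' Set.Iio j)}) := by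
  by_contra hc
  obtain ⟨C, hCs, hC⟩ := ((Matroid.not_indep_iff (Set.subset_univ _)).1 hc).exists_isCircuit_subset
  obtain ⟨x₀, hx₀⟩ := hC.nonempty
  obtain ⟨j₀, -, -⟩ := hCs hx₀
  have : Nonempty J := ⟨j₀⟩
  have hCs' : ∀ x ∈ C, ∃ j, f j ∉ fcCl K (f '' Set.Iio j) ∧ f j = x := fun x hx => hCs hx
  choose! φ hφ using hCs'
  obtain ⟨x, hx, hmax⟩ := hC.finite.exists_maximalFor φ C hC.nonempty
  have h1 := hC.mem_closure_sdiff_singleton_of_mem hx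
  apply (hφ x hx).1
  rw [fcCl_eq, (hφ x hx).2]
  refine Matroid.closure_subset_closure _ ?_ h1
  rintro y ⟨hy, hyx⟩
  refine ⟨φ y, ?_, (hφ y hy).2⟩
  rcases lt_or_ge (φ y) (φ x) with h | h
  · exact h
  · exfalso
    have h' := le_antisymm h (hmax hy h)
    apply hyx
    have := (hφ y hy).2
    rw [← h', (hφ x hx).2] at this
    exact this.symm

theorem fc_greedy_span {F : Type u} [Field F] {K : Subfield F} {J : Type*} [LinearOrder J]
    [WellFoundedLT J] (f : J → F) (j : J) :
    f j ∈ fcCl K (f '' {j | f j ∉ fcCl K (f '' Set.Iio j)}) := by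
  induction j using WellFoundedLT.induction with
  | ind j ih =>
    by_cases h : f j ∈ fcCl K (f '' Set.Iio j)
    · refine fcCl_sub (fcCl_base _ _) ?_ h
      rintro _ ⟨k, hk, rfl⟩
      exact ih k hk
    · exact fcCl_self _ _ ⟨j, h, rfl⟩

theorem fc_acl_mem {n : ℕ} (M : TModel.{u} n) (S : Set M.carrier) :
    aclSigma M S ∈ AclFamily M S := by
  refine ⟨?_, ?_, ?_, ?_⟩
  · intro x hx
    simp only [aclSigma, SetLike.mem_coe, Subfield.mem_sInf]
    exact fun N hN => hN.1 hx
  · intro i x hx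
    simp only [aclSigma, Subfield.mem_sInf] at hx ⊢
    exact fun N hN => hN.2.1 i x (hx N hN)
  · intro i x hx
    simp only [aclSigma, Subfield.mem_sInf] at hx ⊢
    exact fun N hN => hN.2.2.1 i x (hx N hN)
  · intro x hx
    have hx' : IsAlgebraic (aclSigma M S) x := hx
    simp only [aclSigma, Subfield.mem_sInf]
    intro N hN
    apply hN.2.2.2 x
    have hle : aclSigma M S ≤ N := sInf_le hN
    have : IsAlgebraic N x := hx'.ringHom_of_comp_eq (S := N) (Subfield.inclusion hle)
      (RingHom.id _) (RingHom.injective _) rfl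
    exact this

theorem fc_acl_le {n : ℕ} (M : TModel.{u} n) {S : Set M.carrier} {N : Subfield M.carrier}
    (h : N ∈ AclFamily M S) : aclSigma M S ≤ N := sInf_le h

theorem fc_acl_mono {n : ℕ} (M : TModel.{u} n) {S T : Set M.carrier} (h : S ⊆ T) :
    aclSigma M S ≤ aclSigma M T :=
  fc_acl_le M ⟨h.trans (fc_acl_mem M T).1, (fc_acl_mem M T).2⟩

theorem fc_acl_closed {n : ℕ} (M : TModel.{u} n) (S : Set M.carrier) :
    fcCl ⊥ (aclSigma M S : Set M.carrier) ⊆ aclSigma M S := by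
  intro x hx
  apply (fc_acl_mem M S).2.2.2 x
  have h : x ∈ fcCl (aclSigma M S) ∅ := by
    rw [fcCl_bot, Set.union_empty]; exact hx
  have h' : IsAlgebraic (Algebra.adjoin (aclSigma M S) (∅ : Set M.carrier)) x := h
  have key : ∀ y ∈ Algebra.adjoin (aclSigma M S) (∅ : Set M.carrier), y ∈ aclSigma M S := by
    intro y hy
    rw [Algebra.adjoin_empty] at hy
    obtain ⟨r, rfl⟩ := hy
    exact r.2
  have h2 : IsAlgebraic (aclSigma M S) x := by
    refine h'.ringHom_of_comp_eq (S := aclSigma M S)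
      ((algebraMap (Algebra.adjoin (aclSigma M S) (∅ : Set M.carrier)) M.carrier).codRestrict
        (aclSigma M S) (fun r => key r r.2)) (RingHom.id _) ?_ rfl
    intro a b hab
    have hab' := Subtype.ext_iff.1 hab
    exact Subtype.ext hab'
  exact h2

theorem fc_acl_finset {n : ℕ} (M : TModel.{u} n) (A : Set M.carrier) {Y : Set M.carrier}
    (hY : Y.Finite)
    (h : ∀ y ∈ Y, ∃ A₀ : Finset M.carrier, (A₀ : Set M.carrier) ⊆ A ∧ y ∈ aclSigma M A₀) :
    ∃ A₀ : Finset M.carrier, (A₀ : Set M.carrier) ⊆ A ∧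
      Y ⊆ (aclSigma M A₀ : Set M.carrier) := by
  classical
  choose! B hB using h
  refine ⟨hY.toFinset.biUnion B, ?_, ?_⟩
  · intro x hx
    simp only [Finset.coe_biUnion, Set.mem_iUnion, Set.Finite.coe_toFinset] at hx
    obtain ⟨y, hy, hx⟩ := hx
    exact (hB y hy).1 hx
  · intro y hy
    refine fc_acl_mono M ?_ (hB y hy).2
    intro x hx
    simp only [Finset.coe_biUnion, Set.mem_iUnion, Set.Finite.coe_toFinset]
    exact ⟨y, hy, hx⟩

theorem fc_acl_fin {n : ℕ} (M : TModel.{u} n) (A : Set M.carrier) {x : M.carrier}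
    (hx : x ∈ aclSigma M A) :
    ∃ A₀ : Finset M.carrier, (A₀ : Set M.carrier) ⊆ A ∧ x ∈ aclSigma M A₀ := by
  classical
  let U : Set M.carrier :=
    {x | ∃ A₀ : Finset M.carrier, (A₀ : Set M.carrier) ⊆ A ∧ x ∈ aclSigma M A₀}
  have hU : ∀ Y ⊆ U, Y.Finite → ∃ A₀ : Finset M.carrier, (A₀ : Set M.carrier) ⊆ A ∧
      Y ⊆ (aclSigma M A₀ : Set M.carrier) := fun Y hY hf => fc_acl_finset M A hf hY
  have hcl : fcCl ⊥ U ⊆ U := by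
    intro y hy
    obtain ⟨Y, hYU, hYf, hyY⟩ := fcCl_finite (Set.finite_singleton y)
      (Set.singleton_subset_iff.2 hy)
    obtain ⟨A₀, h1, h2⟩ := hU Y hYU hYf
    exact ⟨A₀, h1, fc_acl_closed M _ (fcCl_mono le_rfl h2 (hyY rfl))⟩
  have hcl' : (fcClF ⊥ U : Set M.carrier) = U := subset_antisymm hcl (fcCl_self _ _)
  have hmem : fcClF ⊥ U ∈ AclFamily M A := by
    refine ⟨?_, ?_, ?_, ?_⟩
    · intro y hy
      exact fcCl_self _ _ ⟨{y}, by simpa using hy, (fc_acl_mem M _).1 (by simp)⟩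
    · intro i y hy
      obtain ⟨A₀, h1, h2⟩ := hcl hy
      exact fcCl_self _ _ ⟨A₀, h1, (fc_acl_mem M _).2.1 i y h2⟩
    · intro i y hy
      obtain ⟨A₀, h1, h2⟩ := hcl hy
      exact fcCl_self _ _ ⟨A₀, h1, (fc_acl_mem M _).2.2.1 i y h2⟩
    · intro y hy
      have hy' : IsAlgebraic (fcClF ⊥ U) y := hy
      exact fc_alg _ _ y (fcClF ⊥ U).toSubring (fun z hz => hz) hy'
  exact hcl (fc_acl_le M hmem hx)

theorem fcAct_comm {n : ℕ} (M : TModel.{u} n) : Pairwise fun i j =>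
    ∀ (x y : Multiplicative ℤ), Commute (zpowersHom (RingAut M.carrier) (M.aut i) x)
      (zpowersHom (RingAut M.carrier) (M.aut j) y) := by
  intro i j _ x y
  simp only [zpowersHom_apply]
  refine Commute.zpow_zpow ?_ _ _
  exact RingEquiv.ext fun z => M.comm i j z

/-- The action of `ℤ^n`. -/
noncomputable def fcAct {n : ℕ} (M : TModel.{u} n) :
    (Fin n → Multiplicative ℤ) →* RingAut M.carrier :=
  MonoidHom.noncommPiCoprod (fun i => zpowersHom (RingAut M.carrier) (M.aut i)) (fcAct_comm M)

theorem fcAct_single {n : ℕ} (M : TModel.{u} n) (i : Fin n) (z : Multiplicative ℤ) :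
    fcAct M (Pi.mulSingle i z) = (M.aut i : RingAut M.carrier) ^ z.toAdd := by
  have h := MonoidHom.noncommPiCoprod_mulSingle
    (fun i => zpowersHom (RingAut M.carrier) (M.aut i)) (hcomm := fcAct_comm M) i z
  exact h.trans (zpowersHom_apply _ _ _)

theorem fcAct_closed {n : ℕ} (M : TModel.{u} n) (N : Subfield M.carrier)
    (h1 : ∀ i, ∀ x ∈ N, M.aut i x ∈ N) (h2 : ∀ i, ∀ x ∈ N, (M.aut i).symm x ∈ N)
    (v : Fin n → Multiplicative ℤ) : ∀ x ∈ N, fcAct M v x ∈ N := by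
  let H : Subgroup (RingAut M.carrier) :=
    { carrier := {g | (∀ x ∈ N, g x ∈ N) ∧ (∀ x ∈ N, g⁻¹ x ∈ N)}
      mul_mem' := by
        rintro g h ⟨hg, hg'⟩ ⟨hh, hh'⟩
        refine ⟨fun x hx => hg _ (hh _ hx), fun x hx => ?_⟩
        rw [mul_inv_rev]
        exact hh' _ (hg' _ hx)
      one_mem' := ⟨fun x hx => hx, fun x hx => by rw [inv_one]; exact hx⟩
      inv_mem' := by
        rintro g ⟨hg, hg'⟩
        exact ⟨hg', by rw [inv_inv]; exact hg⟩ }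
  have hH : v ∈ H.comap (fcAct M) := by
    rw [← Finset.univ_prod_mulSingle v]
    refine Subgroup.prod_mem _ fun i _ => ?_
    rw [Subgroup.mem_comap, fcAct_single]
    refine Subgroup.zpow_mem _ ?_ _
    exact ⟨h1 i, h2 i⟩
  exact hH.1

/-- Index type for the monomials, lexicographically ordered. -/
abbrev FcJ (r n : ℕ) := Fin r ×ₗ Lex (Fin n → ℕ)

/-- The inclusion `ℕ^n → ℤ^n`. -/
def fcEmb {n : ℕ} (w : Fin n → ℕ) : Fin n → Multiplicative ℤ :=
  fun k => Multiplicative.ofAdd (w k : ℤ)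

theorem fcEmb_add {n : ℕ} (u v : Fin n → ℕ) : fcEmb (u + v) = fcEmb u * fcEmb v := by
  funext k
  simp [fcEmb]

/-- The elements `σ^w a_i`. -/
noncomputable def fcF {n : ℕ} (M : TModel.{u} n) {r : ℕ} (a : Fin r → M.carrier)
    (j : FcJ r n) : M.carrier :=
  fcAct M (fcEmb (ofLex (ofLex j).2)) (a (ofLex j).1)

/-- Translation on indices. -/
def fcShift {r n : ℕ} (u : Fin n → ℕ) (j : FcJ r n) : FcJ r n :=
  toLex ((ofLex j).1, toLex (u + ofLex (ofLex j).2))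

theorem fcShift_lt {r n : ℕ} (u : Fin n → ℕ) {j k : FcJ r n} (h : j < k) :
    fcShift u j < fcShift u k := by
  rw [Prod.Lex.lt_iff] at h ⊢
  rcases h with h | ⟨h, h'⟩
  · exact Or.inl h
  · refine Or.inr ⟨h, ?_⟩
    obtain ⟨i, h1, h2⟩ := h'
    refine ⟨i, fun l hl => ?_, ?_⟩
    · exact congrArg (u l + ·) (h1 l hl)
    · exact Nat.add_lt_add_left h2 (u i)

theorem fcF_shift {n : ℕ} (M : TModel.{u} n) {r : ℕ} (a : Fin r → M.carrier)
    (u : Fin n → ℕ) (j : FcJ r n) :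
    fcF M a (fcShift u j) = fcAct M (fcEmb u) (fcF M a j) := by
  have : fcAct M (fcEmb (u + ofLex (ofLex j).2)) =
      fcAct M (fcEmb u) * fcAct M (fcEmb (ofLex (ofLex j).2)) := by
    rw [fcEmb_add, map_mul]
  exact congrArg (fun g : RingAut M.carrier => g (a (ofLex j).1)) this

theorem fc_up {n : ℕ} (M : TModel.{u} n) {r : ℕ} (a : Fin r → M.carrier)
    {K : Subfield M.carrier} (hK : ∀ v, ∀ x ∈ K, fcAct M v x ∈ K)
    (u : Fin n → ℕ) {j : FcJ r n} (h : fcF M a j ∈ fcCl K (fcF M a '' Set.Iio j)) :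
    fcF M a (fcShift u j) ∈ fcCl K (fcF M a '' Set.Iio (fcShift u j)) := by
  rw [fcF_shift]
  refine fcCl_mono le_rfl ?_ (fcCl_equiv (fcAct M (fcEmb u)) (hK _) h)
  rintro _ ⟨_, ⟨k, hk, rfl⟩, rfl⟩
  exact ⟨fcShift u k, fcShift_lt u hk, fcF_shift M a u k⟩

theorem fc_acl_act {n : ℕ} (M : TModel.{u} n) (S : Set M.carrier)
    (v : Fin n → Multiplicative ℤ) : ∀ x ∈ aclSigma M S, fcAct M v x ∈ aclSigma M S :=
  fcAct_closed M _ (fc_acl_mem M S).2.1 (fc_acl_mem M S).2.2.1 v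

/-- Choice of the finite set. -/
theorem fc_choose {n : ℕ} (M : TModel.{u} n) {r : ℕ} (a : Fin r → M.carrier)
    (A : Set M.carrier) :
    ∃ A₀ : Finset M.carrier, (A₀ : Set M.carrier) ⊆ A ∧ ∀ j : FcJ r n,
      fcF M a j ∈ fcCl (aclSigma M A) (fcF M a '' Set.Iio j) →
      fcF M a j ∈ fcCl (aclSigma M A₀) (fcF M a '' Set.Iio j) := by
  classical
  let P : Fin r → (Fin n → ℕ) → Prop := fun i w =>
    fcF M a (toLex (i, toLex w)) ∈
      fcCl (aclSigma M A) (fcF M a '' Set.Iio (toLex (i, toLex w)))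
  have hfin : ∀ i, {w | Minimal (P i) w}.Finite := fun i =>
    WellQuasiOrderedLE.finite_of_isAntichain (setOfPred_minimal_antichain (P i))
  let Jm : Set (FcJ r n) := ⋃ i, (fun w => toLex (i, toLex w)) '' {w | Minimal (P i) w}
  have hJm : Jm.Finite := Set.finite_iUnion fun i => (hfin i).image _
  have hY : ∀ j ∈ Jm, ∃ Y : Set M.carrier,
      Y ⊆ (aclSigma M A : Set M.carrier) ∪ fcF M a '' Set.Iio j ∧ Y.Finite ∧
      fcF M a j ∈ fcCl ⊥ Y := by
    intro j hj
    obtain ⟨i, hi⟩ := Set.mem_iUnion.1 hj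
    obtain ⟨w, hw, rfl⟩ := hi
    have h : P i w := hw.prop
    simp only [P] at h
    rw [fcCl_bot] at h
    obtain ⟨Y, h1, h2, h3⟩ := fcCl_finite (Set.finite_singleton _)
      (Set.singleton_subset_iff.2 h)
    exact ⟨Y, h1, h2, h3 rfl⟩
  choose! Y hY using hY
  obtain ⟨A₀, hA₀, hZ⟩ := fc_acl_finset M A
    (Y := ⋃ j ∈ Jm, Y j ∩ (aclSigma M A : Set M.carrier))
    (hJm.biUnion fun j hj => (hY j hj).2.1.inter_of_left _) (by
      intro y hy
      simp only [Set.mem_iUnion] at hy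
      obtain ⟨j, -, hy⟩ := hy
      exact fc_acl_fin M A hy.2)
  refine ⟨A₀, hA₀, ?_⟩
  have hmin : ∀ j ∈ Jm, fcF M a j ∈ fcCl (aclSigma M A₀) (fcF M a '' Set.Iio j) := by
    intro j hj
    rw [fcCl_bot]
    refine fcCl_mono le_rfl ?_ (hY j hj).2.2
    intro y hy
    rcases (hY j hj).1 hy with h | h
    · refine Or.inl (hZ ?_)
      simp only [Set.mem_iUnion]
      exact ⟨j, hj, hy, h⟩
    · exact Or.inr h
  intro j hj
  obtain ⟨w, hw, hwm⟩ := exists_minimal_le_of_wellFoundedLT (P (ofLex j).1)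
    (ofLex (ofLex j).2) hj
  have hj' : j = fcShift (ofLex (ofLex j).2 - w) (toLex ((ofLex j).1, toLex w)) := by
    have : ofLex (ofLex j).2 - w + w = ofLex (ofLex j).2 := tsub_add_cancel_of_le hw
    simp only [fcShift, ofLex_toLex, this]
    rfl
  rw [hj']
  exact fc_up M a (fc_acl_act M _) _ (hmin _ (Set.mem_iUnion.2 ⟨_, w, hwm, rfl⟩))

theorem fc_acl_span {n : ℕ} (M : TModel.{u} n) {r : ℕ} (a : Fin r → M.carrier)
    (B : Set M.carrier) : (aclSigma M (B ∪ Set.range a) : Set M.carrier) ⊆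
      fcCl (aclSigma M B) {y | ∃ v i, y = fcAct M v (a i)} := by
  set S : Set M.carrier := {y | ∃ v i, y = fcAct M v (a i)} with hS
  have hact : ∀ v, ∀ x ∈ fcCl (aclSigma M B) S, fcAct M v x ∈ fcCl (aclSigma M B) S := by
    intro v x hx
    refine fcCl_mono le_rfl ?_ (fcCl_equiv (fcAct M v) (fc_acl_act M B v) hx)
    rintro _ ⟨_, ⟨w, i, rfl⟩, rfl⟩
    refine ⟨v * w, i, ?_⟩
    rw [map_mul]; rfl
  have hmem : fcClF (aclSigma M B) S ∈ AclFamily M (B ∪ Set.range a) := by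
    refine ⟨Set.union_subset ((fc_acl_mem M B).1.trans (fcCl_base _ _)) ?_, ?_, ?_, ?_⟩
    · rintro _ ⟨i, rfl⟩
      refine fcCl_self _ _ ⟨1, i, ?_⟩
      rw [map_one]; rfl
    · intro i x hx
      have h := hact (Pi.mulSingle i (Multiplicative.ofAdd 1)) x hx
      rw [fcAct_single, toAdd_ofAdd, zpow_one] at h
      exact h
    · intro i x hx
      have h := hact (Pi.mulSingle i (Multiplicative.ofAdd (-1))) x hx
      rw [fcAct_single, toAdd_ofAdd, zpow_neg_one] at h
      exact h
    · intro y hy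
      have hy' : IsAlgebraic (fcClF (aclSigma M B) S) y := hy
      exact fc_alg _ _ y (fcClF (aclSigma M B) S).toSubring (fun z hz => hz) hy'
  exact fc_acl_le M hmem

theorem fc_tuple_iff {F : Type u} [Field F] (k : Subfield F) {m : ℕ} (x : Fin m → F) :
    AlgIndepTuple k x ↔ AlgebraicIndependent k x := by
  rw [algebraicIndependent_iff]; rfl

theorem fc_tuple_act {n : ℕ} (M : TModel.{u} n) {K : Subfield M.carrier}
    (hK : ∀ v, ∀ x ∈ K, fcAct M v x ∈ K) (v : Fin n → Multiplicative ℤ)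
    {m : ℕ} {x : Fin m → M.carrier} (h : AlgebraicIndependent K (fun l => fcAct M v (x l))) :
    AlgebraicIndependent K x := by
  refine AlgebraicIndependent.of_ringHom_of_comp_eq (S := K) (x := x)
    ((((fcAct M v : M.carrier ≃+* M.carrier) : M.carrier →+* M.carrier).comp
      K.subtype).codRestrict K (fun r => hK v r r.2))
    ((fcAct M v : M.carrier ≃+* M.carrier) : M.carrier →+* M.carrier) h
    (RingHom.injective _) rfl

theorem fc_shift_exists {n : ℕ} (M : TModel.{u} n) {r : ℕ} (a : Fin r → M.carrier)
    {Y : Set M.carrier} (hY : Y.Finite) (h : Y ⊆ {y | ∃ v i, y = fcAct M v (a i)}) :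
    ∃ u : Fin n → ℕ, ∀ y ∈ Y, fcAct M (fcEmb u) y ∈ Set.range (fcF M a) := by
  have h' : ∀ y ∈ Y, ∃ v, ∃ i, y = fcAct M v (a i) := fun y hy => h hy
  choose! V hV using h'
  refine ⟨fun k => ∑ y ∈ hY.toFinset, ((V y k).toAdd).natAbs, fun y hy => ?_⟩
  obtain ⟨i₀, h4⟩ := hV y hy
  set U : Fin n → ℕ := fun k => ∑ y ∈ hY.toFinset, ((V y k).toAdd).natAbs with hU
  have hle : ∀ k, ((V y k).toAdd).natAbs ≤ U k := fun k =>
    Finset.single_le_sum (f := fun y => ((V y k).toAdd).natAbs) (fun _ _ => Nat.zero_le _)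
      (hY.mem_toFinset.2 hy)
  refine ⟨toLex (i₀, toLex fun k => ((U k : ℤ) + (V y k).toAdd).toNat), ?_⟩
  have h1 : fcEmb (fun k => ((U k : ℤ) + (V y k).toAdd).toNat) = fcEmb U * V y := by
    funext k
    have := hle k
    have h2 : ((((U k : ℤ) + (V y k).toAdd).toNat : ℕ) : ℤ) = (U k : ℤ) + (V y k).toAdd :=
      Int.toNat_of_nonneg (by omega)
    simp only [fcEmb, h2, Pi.mul_apply]
    rfl
  have h3 : fcF M a (toLex (i₀, toLex fun k => ((U k : ℤ) + (V y k).toAdd).toNat)) =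
      fcAct M (fcEmb (fun k => ((U k : ℤ) + (V y k).toAdd).toNat)) (a (i₀)) := rfl
  rw [h3, h1, map_mul]
  calc _ = fcAct M (fcEmb U) (fcAct M (V y) (a (i₀))) := rfl
    _ = _ := by rw [← h4]

/-- finite character of independence: for a relatively algebraically
closed model `M` of `T`, a finite tuple `a` from `M` and `A ⊆ M`, there is a finite
`A₀ ⊆ A` such that `acl_σ^M(A₀ ∪ a)` and `acl_σ^M(A)` are algebraically independent
over `acl_σ^M(A₀)`. -/
theorem finite_character_of_independence {n : ℕ} (hn : 1 ≤ n)
    (M : TModel.{u} n) (hM : IsRAC M)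
    {r : ℕ} (a : Fin r → M.carrier) (A : Set M.carrier) :
    ∃ A₀ : Finset M.carrier, ↑A₀ ⊆ A ∧
      FieldAlgIndep (aclSigma M (↑A₀ ∪ Set.range a)) (aclSigma M A)
        (aclSigma M ↑A₀) := by
  obtain ⟨A₀, hA₀, hL⟩ := fc_choose M a A
  refine ⟨A₀, hA₀, ?_⟩
  have hle : aclSigma M (A₀ : Set M.carrier) ≤ aclSigma M A := fc_acl_mono M hA₀
  intro m x hx hind
  rw [fc_tuple_iff] at hind ⊢
  obtain ⟨Y, hYS, hYf, hXY⟩ := fcCl_finite (Set.finite_range x)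
    (show Set.range x ⊆ fcCl (aclSigma M A₀) {y | ∃ v i, y = fcAct M v (a i)} by
      rintro _ ⟨l, rfl⟩
      exact fc_acl_span M a _ (hx l))
  obtain ⟨U, hU⟩ := fc_shift_exists M a hYf hYS
  set g := fcAct M (fcEmb U) with hg
  -- the translated tuple is independent over the small field
  have hind' : AlgebraicIndependent (aclSigma M (A₀ : Set M.carrier)) (fun l => g (x l)) := by
    refine fc_tuple_act M (fc_acl_act M _) (fcEmb U)⁻¹ ?_
    have : (fun l => fcAct M (fcEmb U)⁻¹ (g (x l))) = x := by
      funext l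
      rw [map_inv]
      exact g.symm_apply_apply (x l)
    rw [this]; exact hind
  refine fc_tuple_act M (fc_acl_act M _) (fcEmb U) ?_
  have hindep : (AlgebraicIndependent.matroid (aclSigma M A) M.carrier).Indep
      (Set.range fun l => g (x l)) := by
    refine fc_transfer hle (fc_greedy_indep (K := aclSigma M A) (fcF M a))
      (AlgebraicIndependent.matroid_indep_iff.2 hind'.to_subtype_range) (Set.finite_range _) ?_
    have hN : {j | fcF M a j ∉ fcCl (aclSigma M A) (fcF M a '' Set.Iio j)} =
        {j | fcF M a j ∉ fcCl (aclSigma M (A₀ : Set M.carrier)) (fcF M a '' Set.Iio j)} := by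
      ext j
      exact not_congr ⟨hL j, fun h => fcCl_mono hle le_rfl h⟩
    rw [hN]
    rintro _ ⟨l, rfl⟩
    refine fcCl_sub (fcCl_base _ _) ?_
      (fcCl_equiv g (fc_acl_act M _ _) (hXY ⟨l, rfl⟩))
    rintro _ ⟨y, hy, rfl⟩
    obtain ⟨j, hj⟩ := hU y hy
    rw [← hj]
    exact fc_greedy_span (fcF M a) j
  rw [AlgebraicIndependent.matroid_indep_iff] at hindep
  exact (algebraicIndependent_subtype_range hind'.injective).1 hindep
end

section
/- Fix n ≥ 1, let M be a relatively algebraically closed model of T, and for subsets X, Y, Z ⊆ M write X ⫝_Z Y to mean that acl_σ^M(X ∪ Z) and acl_σ^M(Y ∪ Z) are algebraically independent over acl_σ^M(Z). Then: (local character) if ā ⊆ M is a (possibly infinite) tuple, A, B ⊆ M, and ā ⫝̸_A B, then there is a finite tuple b from B with ā ⫝̸_A b; (monotonicity) if A ⊆ B ⊆ C ⊆ D ⊆ M and ā ⫝_A D, then ā ⫝_B C; (transitivity) if A ⊆ B ⊆ C ⊆ M and ā ⫝_A B and ā ⫝_B C, then ā ⫝_A C; (symmetry) if ā ⫝_A b̄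 then b̄ ⫝_A ā. -/
universe u

/-- The independence relation: `X ⫝_Z Y` iff `acl_σ^M(X ∪ Z)` and `acl_σ^M(Y ∪ Z)`
are algebraically independent over `acl_σ^M(Z)`. -/
def Indep {n : ℕ} (M : TModel.{u} n) (X Y Z : Set M.carrier) : Prop :=
  FieldAlgIndep (aclSigma M (X ∪ Z)) (aclSigma M (Y ∪ Z)) (aclSigma M Z)

section Helpers

variable {L : Type u} [Field L]

/-- Relatively algebraically closed subfield. -/
def RelClosed (N : Subfield L) : Prop := ∀ x : L, IsAlgebraic N x → x ∈ N

theorem algIndepTuple_iff (k : Subfield L) {m : ℕ} (x : Fin m → L) :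
    AlgIndepTuple k x ↔ AlgebraicIndependent k x := by
  rw [algebraicIndependent_iff]; rfl

theorem AI_mono {ι : Type*} {k K : Subfield L} (h : k ≤ K) {x : ι → L}
    (hx : AlgebraicIndependent K x) : AlgebraicIndependent k x :=
  AlgebraicIndependent.of_ringHom_of_comp_eq (Subfield.inclusion h) (RingHom.id L)
    (by simpa using hx) (Subfield.inclusion h).injective rfl

theorem IsAlgebraic_map {N N' : Subfield L} (σ : L →+* L) (h : ∀ a ∈ N, σ a ∈ N') {x : L}
    (hx : IsAlgebraic N x) : IsAlgebraic N' (σ x) := by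
  let f : N →+* N' := (σ.comp N.subtype).codRestrict N' (fun a => h a a.2)
  exact hx.ringHom_of_comp_eq f σ f.injective rfl

theorem IsAlgebraic_mono {N N' : Subfield L} (h : N ≤ N') {x : L}
    (hx : IsAlgebraic N x) : IsAlgebraic N' x :=
  IsAlgebraic_map (RingHom.id L) h hx

theorem indep_any {E F k : Subfield L} (h : FieldAlgIndep E F k) {ι : Type*} (x : ι → L)
    (hxE : ∀ i, x i ∈ E) (hx : AlgebraicIndependent k x) : AlgebraicIndependent F x := by
  apply algebraicIndependent_of_finite_type
  intro t ht
  obtain ⟨m, ⟨e⟩⟩ := @Finite.exists_equiv_fin t ht.to_subtype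
  have h1 : AlgebraicIndependent k (fun j : Fin m => x (e.symm j)) :=
    hx.comp (fun j : Fin m => (e.symm j : ι))
      (Subtype.val_injective.comp e.symm.injective)
  have h2 := (algIndepTuple_iff _ _).1 (h m _ (fun _ => hxE _) ((algIndepTuple_iff _ _).2 h1))
  exact (algebraicIndependent_equiv' e (by ext; simp)).2 h2

theorem exists_closure {k : Subfield L} {ι κ : Type*} {z : κ → L} {y : ι → L}
    (hy : AlgebraicIndependent (Algebra.adjoin k (Set.range z)) y) :
    ∃ N : Subfield L, RelClosed N ∧ k ≤ N ∧
      (∀ a, IsAlgebraic (Algebra.adjoin k (Set.range z)) a → a ∈ N) ∧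
      AlgebraicIndependent N y := by
  rw [← IntermediateField.algebraicIndependent_adjoin_iff] at hy
  refine ⟨(algebraicClosure (IntermediateField.adjoin k (Set.range z)) L).toSubfield,
    ?_, ?_, ?_, hy.algebraicClosure⟩
  · intro x hx
    have hx' : IsAlgebraic (algebraicClosure (IntermediateField.adjoin k (Set.range z)) L) x := hx
    exact mem_algebraicClosure_iff.2
      (hx'.restrictScalars (IntermediateField.adjoin k (Set.range z)))
  · intro a ha
    exact mem_algebraicClosure_iff.2 (isAlgebraic_algebraMap
      (algebraMap k (IntermediateField.adjoin k (Set.range z)) ⟨a, ha⟩))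
  · intro a ha
    exact mem_algebraicClosure_iff.2 (IntermediateField.isAlgebraic_adjoin_iff.2 ha)

theorem exists_basis (k : Subfield L) (E : Set L) : ∃ T : Set L, T ⊆ E ∧
    AlgebraicIndependent k ((↑) : T → L) ∧
    ∀ a ∈ E, IsAlgebraic (Algebra.adjoin k (Set.range ((↑) : T → L))) a := by
  obtain ⟨T, hT⟩ := (AlgebraicIndependent.matroid k L).exists_isBasis E
  rw [AlgebraicIndependent.matroid_isBasis_iff] at hT
  refine ⟨T, hT.2.1, hT.1, ?_⟩
  rw [Subtype.range_coe]
  exact hT.2.2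

theorem sum_tower {k F : Subfield L} (h : k ≤ F) {ι κ : Type*} {x : ι → L} {y : κ → L}
    (hx : AlgebraicIndependent k x) (hxF : ∀ i, x i ∈ F) (hy : AlgebraicIndependent F y) :
    AlgebraicIndependent k (Sum.elim y x) := by
  letI : Algebra k F := (Subfield.inclusion h).toAlgebra
  haveI : IsScalarTower k F L := IsScalarTower.of_algebraMap_eq (fun _ => rfl)
  refine hx.sumElim_of_tower (S := F) ?_ hy
  rintro _ ⟨i, rfl⟩
  exact ⟨⟨x i, hxF i⟩, rfl⟩

theorem indep_symm {E F k : Subfield L} (hF : k ≤ F)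
    (h : FieldAlgIndep E F k) : FieldAlgIndep F E k := by
  intro m y hyF hy
  rw [algIndepTuple_iff] at hy ⊢
  obtain ⟨T, hTE, hT, hTa⟩ := exists_basis k (E : Set L)
  have h1 := indep_any h _ (fun i : T => hTE i.2) hT
  have h2 := sum_tower hF hy hyF h1
  have h3 : AlgebraicIndependent k (Sum.elim y ((↑) : T → L)) :=
    (algebraicIndependent_equiv' (Equiv.sumComm _ _) (by ext (i | i) <;> rfl)).2 h2
  obtain ⟨N, -, -, hN, hNy⟩ := exists_closure (AlgebraicIndependent.sumElim_iff.1 h3).2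
  exact AI_mono (fun a ha => hN a (hTa a ha)) hNy

theorem indep_base {E F k G F' k' : Subfield L} (hE : k ≤ E) (hk : k ≤ k')
    (hk' : k' ≤ F') (hF' : F' ≤ F) (hG' : k' ≤ G)
    (hG : ∀ N : Subfield L, E ≤ N → k' ≤ N → RelClosed N → G ≤ N)
    (h : FieldAlgIndep E F k) : FieldAlgIndep G F' k' := by
  have hs := indep_symm (hk.trans (hk'.trans hF')) h
  refine indep_symm hG' ?_
  intro m y hyF hy
  rw [algIndepTuple_iff] at hy ⊢
  obtain ⟨T, hTE, hT, hTa⟩ := exists_basis k (k' : Set L)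
  have h2 := sum_tower hk hT (fun i : T => hTE i.2) hy
  have h3 := indep_any hs _ (by
    rintro (i | i)
    · exact hF' (hyF i)
    · exact hF' (hk' (hTE i.2))) h2
  obtain ⟨N, hNc, hEN, hN, hNy⟩ := exists_closure (AlgebraicIndependent.sumElim_iff.1 h3).2
  refine AI_mono (hG N hEN (fun a ha => hN a ?_) hNc) hNy
  have ha' := hTa a ha
  have hle : ∀ b ∈ Algebra.adjoin k (Set.range ((↑) : T → L)),
      b ∈ Algebra.adjoin E (Set.range ((↑) : T → L)) := by
    intro b hb
    induction hb using Algebra.adjoin_induction with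
    | mem x hx => exact Algebra.subset_adjoin hx
    | algebraMap r => exact (Algebra.adjoin E _).algebraMap_mem ⟨r, hE r.2⟩
    | add x y _ _ hx hy => exact add_mem hx hy
    | mul x y _ _ hx hy => exact mul_mem hx hy
  let f : Algebra.adjoin k (Set.range ((↑) : T → L)) →+*
      Algebra.adjoin E (Set.range ((↑) : T → L)) :=
    (Algebra.adjoin k (Set.range ((↑) : T → L))).val.toRingHom.codRestrict _
      (fun b => hle b b.2)
  exact ha'.ringHom_of_comp_eq f (RingHom.id L)
    (fun a b hab => Subtype.ext (congrArg Subtype.val hab :)) rfl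

theorem directed_AI {η ι : Type*} [Nonempty η] {S : η → Subfield L} (hS : Directed (· ≤ ·) S)
    {x : ι → L} (hx : ∀ i, AlgebraicIndependent (S i) x) :
    AlgebraicIndependent (⨆ i, S i : Subfield L) x := by
  rw [algebraicIndependent_iff]
  intro p hp
  have h1 : ∀ m, ∃ i, ((p.coeff m : (⨆ i, S i : Subfield L)) : L) ∈ S i := fun m =>
    (Subfield.mem_iSup_of_directed hS).1 (p.coeff m).2
  choose g hg using h1
  classical
  obtain ⟨i, hi⟩ := hS.finset_le (p.support.image g)
  have hle : S i ≤ ⨆ i, S i := le_iSup S i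
  have hr : p ∈ Set.range (MvPolynomial.map (σ := ι) (Subfield.inclusion hle)) := by
    rw [MvPolynomial.mem_range_map_iff_coeffs_subset]
    intro c hc
    obtain ⟨m, hm, rfl⟩ := MvPolynomial.mem_coeffs_iff.1 hc
    exact ⟨⟨_, hi (g m) (Finset.mem_image_of_mem _ hm) (hg m)⟩, rfl⟩
  obtain ⟨q, rfl⟩ := hr
  have : q = 0 := by
    refine (algebraicIndependent_iff.1 (hx i)) q ?_
    rw [MvPolynomial.aeval_def, MvPolynomial.eval₂_map] at hp
    exact hp
  rw [this, map_zero]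

theorem directed_relClosed {η : Type*} [Nonempty η] {S : η → Subfield L}
    (hS : Directed (· ≤ ·) S) (hx : ∀ i, RelClosed (S i)) :
    RelClosed (⨆ i, S i : Subfield L) := by
  intro x hxa
  by_contra hcon
  have : AlgebraicIndependent (⨆ i, S i : Subfield L) (fun _ : Unit => x) := by
    apply directed_AI hS
    intro i
    rw [algebraicIndependent_unique_type_iff]
    intro ha
    exact hcon (le_iSup S i (hx i x ha))
  rw [algebraicIndependent_unique_type_iff] at this
  exact this hxa

theorem relClosed_sInf {s : Set (Subfield L)} (h : ∀ N ∈ s, RelClosed N) :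
    RelClosed (sInf s) := by
  intro x hx
  rw [Subfield.mem_sInf]
  intro N hN
  exact h N hN x (IsAlgebraic_mono (sInf_le hN) hx)

theorem relClosed_comap {N : Subfield L} (h : RelClosed N) (σ : L →+* L) :
    RelClosed (N.comap σ) := fun x hx =>
  h _ (IsAlgebraic_map (N' := N) σ (fun _ ha => ha) hx)

end Helpers

section Acl

variable {n : ℕ} (M : TModel.{u} n)

theorem mem_aclFamily {S : Set M.carrier} {N : Subfield M.carrier} :
    N ∈ AclFamily M S ↔ S ⊆ N ∧ (∀ i, ∀ x ∈ N, M.aut i x ∈ N) ∧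
      (∀ i, ∀ x ∈ N, (M.aut i).symm x ∈ N) ∧ RelClosed N := Iff.rfl

theorem aclSigma_mem (S : Set M.carrier) : aclSigma M S ∈ AclFamily M S := by
  rw [mem_aclFamily]
  unfold aclSigma
  refine ⟨?_, ?_, ?_, relClosed_sInf fun N hN => hN.2.2.2⟩
  · intro x hx
    exact Subfield.mem_sInf.2 fun N hN => hN.1 hx
  · intro i x hx
    rw [Subfield.mem_sInf] at hx ⊢
    exact fun N hN => hN.2.1 i x (hx N hN)
  · intro i x hx
    rw [Subfield.mem_sInf] at hx ⊢
    exact fun N hN => hN.2.2.1 i x (hx N hN)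

theorem aclSigma_le {S : Set M.carrier} {N : Subfield M.carrier} (h : N ∈ AclFamily M S) :
    aclSigma M S ≤ N := sInf_le h

theorem aclSigma_mono {S T : Set M.carrier} (h : S ⊆ T) : aclSigma M S ≤ aclSigma M T :=
  aclSigma_le M ⟨h.trans (aclSigma_mem M T).1, (aclSigma_mem M T).2⟩

theorem aclSigma_union_le (S T : Set M.carrier) (N : Subfield M.carrier)
    (hS : aclSigma M S ≤ N) (hT : aclSigma M T ≤ N) (hN : RelClosed N) :
    aclSigma M (S ∪ T) ≤ N := by
  let fam : Set (Subfield M.carrier) :=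
    {N | aclSigma M S ≤ N ∧ aclSigma M T ≤ N ∧ RelClosed N}
  have key : ∀ σ : M.carrier →+* M.carrier, (∀ x ∈ aclSigma M S, σ x ∈ aclSigma M S) →
      (∀ x ∈ aclSigma M T, σ x ∈ aclSigma M T) → ∀ x ∈ sInf fam, σ x ∈ sInf fam := by
    intro σ h1 h2 x hx
    rw [Subfield.mem_sInf] at hx ⊢
    intro N hN
    exact hx (N.comap σ) ⟨fun a ha => hN.1 (h1 a ha), fun a ha => hN.2.1 (h2 a ha),
      relClosed_comap hN.2.2 σ⟩
  have hle : sInf fam ≤ N := sInf_le ⟨hS, hT, hN⟩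
  refine le_trans (aclSigma_le M (mem_aclFamily M |>.2 ⟨?_, ?_, ?_, ?_⟩)) hle
  · apply Set.union_subset
    · exact fun x hx => Subfield.mem_sInf.2 fun N hN => hN.1 ((aclSigma_mem M S).1 hx)
    · exact fun x hx => Subfield.mem_sInf.2 fun N hN => hN.2.1 ((aclSigma_mem M T).1 hx)
  · exact fun i => key (M.aut i : M.carrier →+* M.carrier)
      ((aclSigma_mem M S).2.1 i) ((aclSigma_mem M T).2.1 i)
  · exact fun i => key ((M.aut i).symm : M.carrier →+* M.carrier)
      ((aclSigma_mem M S).2.2.1 i) ((aclSigma_mem M T).2.2.1 i)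
  · exact relClosed_sInf fun N hN => hN.2.2

theorem aclSigma_finitary (A B : Set M.carrier) :
    Directed (· ≤ ·) (fun b : {b : Finset M.carrier // (b : Set M.carrier) ⊆ B} =>
      aclSigma M ((b.1 : Set M.carrier) ∪ A)) ∧
    aclSigma M (B ∪ A) ≤ ⨆ b : {b : Finset M.carrier // (b : Set M.carrier) ⊆ B},
      aclSigma M ((b.1 : Set M.carrier) ∪ A) := by
  classical
  have hne : Nonempty {b : Finset M.carrier // (b : Set M.carrier) ⊆ B} := ⟨⟨∅, by simp⟩⟩
  have hd : Directed (· ≤ ·) (fun b : {b : Finset M.carrier // (b : Set M.carrier) ⊆ B} =>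
      aclSigma M ((b.1 : Set M.carrier) ∪ A)) := by
    intro b c
    refine ⟨⟨b.1 ∪ c.1, by simpa using ⟨b.2, c.2⟩⟩, aclSigma_mono M ?_, aclSigma_mono M ?_⟩
    · exact Set.union_subset_union_left _ (by simp)
    · exact Set.union_subset_union_left _ (by simp)
  refine ⟨hd, aclSigma_le M (mem_aclFamily M |>.2 ⟨?_, ?_, ?_, ?_⟩)⟩
  · rintro x (hx | hx)
    · exact (Subfield.mem_iSup_of_directed hd).2 ⟨⟨{x}, by simpa using hx⟩,
        (aclSigma_mem M _).1 (Or.inl (by simp))⟩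
    · exact (Subfield.mem_iSup_of_directed hd).2 ⟨hne.some,
        (aclSigma_mem M _).1 (Or.inr hx)⟩
  · intro i x hx
    rw [Subfield.mem_iSup_of_directed hd] at hx ⊢
    obtain ⟨b, hb⟩ := hx
    exact ⟨b, (aclSigma_mem M _).2.1 i x hb⟩
  · intro i x hx
    rw [Subfield.mem_iSup_of_directed hd] at hx ⊢
    obtain ⟨b, hb⟩ := hx
    exact ⟨b, (aclSigma_mem M _).2.2.1 i x hb⟩
  · exact directed_relClosed hd fun b => (aclSigma_mem M _).2.2.2

end Acl

universe u'

/-- the independence relation on a relatively algebraically closed model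
of `T` satisfies local character, monotonicity, transitivity and symmetry. -/
theorem independence_properties {n : ℕ} (hn : 1 ≤ n)
    (M : TModel.{u} n) (hM : IsRAC M) :
    -- local character
    (∀ (ι : Type u') (abar : ι → M.carrier) (A B : Set M.carrier),
      ¬ Indep M (Set.range abar) B A →
        ∃ b : Finset M.carrier, ↑b ⊆ B ∧ ¬ Indep M (Set.range abar) ↑b A) ∧
    -- monotonicity
    (∀ (ι : Type u') (abar : ι → M.carrier) (A B C D : Set M.carrier),
      A ⊆ B → B ⊆ C → C ⊆ D →
        Indep M (Set.range abar) D A → Indep M (Set.range abar) C B) ∧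
    -- transitivity
    (∀ (ι : Type u') (abar : ι → M.carrier) (A B C : Set M.carrier),
      A ⊆ B → B ⊆ C →
        Indep M (Set.range abar) B A → Indep M (Set.range abar) C B →
          Indep M (Set.range abar) C A) ∧
    -- symmetry
    (∀ (ι κ : Type u') (abar : ι → M.carrier) (bbar : κ → M.carrier)
        (A : Set M.carrier),
      Indep M (Set.range abar) (Set.range bbar) A →
        Indep M (Set.range bbar) (Set.range abar) A) := by
  refine ⟨?_, ?_, ?_, ?_⟩
  · intro ι abar A B h
    by_contra hcon
    push Not at hcon
    apply h
    intro m x hxE hx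
    rw [algIndepTuple_iff]
    obtain ⟨hd, hle⟩ := aclSigma_finitary M A B
    have hne : Nonempty {b : Finset M.carrier // (b : Set M.carrier) ⊆ B} := ⟨⟨∅, by simp⟩⟩
    refine AI_mono hle (directed_AI hd fun b => ?_)
    rw [← algIndepTuple_iff]
    exact hcon b.1 b.2 m x hxE hx
  · intro ι abar A B C D hAB hBC hCD h
    unfold Indep at h ⊢
    refine indep_base (aclSigma_mono M Set.subset_union_right) (aclSigma_mono M hAB)
      (aclSigma_mono M Set.subset_union_right) (aclSigma_mono M ?_)
      (aclSigma_mono M Set.subset_union_right) ?_ h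
    · exact (Set.union_subset hCD (hBC.trans hCD)).trans Set.subset_union_left
    · intro N hE hB hN
      refine le_trans (aclSigma_mono M ?_)
        (aclSigma_union_le M (Set.range abar ∪ A) B N hE hB hN)
      exact Set.union_subset_union_left _ Set.subset_union_left
  · intro ι abar A B C hAB hBC h1 h2 m x hxE hx
    have e1 : B ∪ A = B := Set.union_eq_left.2 hAB
    have e2 : C ∪ B = C := Set.union_eq_left.2 hBC
    have e3 : C ∪ A = C := Set.union_eq_left.2 (hAB.trans hBC)
    unfold Indep at h1 h2
    rw [e1] at h1
    rw [e2] at h2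
    rw [e3]
    exact h2 m x (fun l => aclSigma_mono M (Set.union_subset_union_right _ hAB) (hxE l))
      (h1 m x hxE hx)
  · intro ι κ abar bbar A h
    exact indep_symm (aclSigma_mono M Set.subset_union_right) h
end
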